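/- Let k>1, K ∈ C¹(H²), and let Ω be an open set whose closure is a compact subset of H². Then there exist ε̄ > 0 and, for every (ε,z) ∈ [−ε̄,ε̄] × cl Ω, an embedded C² 2π-periodic curve u^ε_z : ℝ → H² such that: (i) u⁰_z = ω_z; (ii) ∫₀^{2π}(u^ε_z−ω_z)·ω' dt = ∫₀^{2π}(u^ε_z−ω_z)·(1,0) dt = ∫₀^{2π}(u^ε_z−ω_z)·ω dt = 0; (iii) there exist real numbers ϑ₁^ε(z), ϑ₂^ε(z) with −(u^ε_z)'' + (u^ε_z)₂⁻¹Γ((u^ε_z)') + L(u^ε_z)(k+εK(u^ε_z)) i(u^ε_z)' = ((u^ε_z)₂)² (ϑ₁^ε(z)(1,0) + ϑ₂^ε(z)ω) pointwise; (iv) sup_{z∈cl Ω} sup_{t∈ℝ} ( |u^ε_z(t)−ω_z(t)| + |(u^ε_z)'(t)−ω_z'(t)| + |(u^ε_z)''(t)−ω_z''(t)| ) → 0 as ε → 0. -/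

import Mathlib

open Real MeasureTheory Filter Topology

noncomputable section

/-- Rotation by π/2 in the plane: `iw = (-w₂, w₁)`. -/
def rot (w : ℝ × ℝ) : ℝ × ℝ := (-w.2, w.1)

/-- The Christoffel-type term `Γ(w) = (2w₁w₂, w₂² - w₁²)`. -/
def Gam (w : ℝ × ℝ) : ℝ × ℝ := (2 * w.1 * w.2, w.2 ^ 2 - w.1 ^ 2)

/-- Euclidean dot product in ℝ². -/
def dotp (v w : ℝ × ℝ) : ℝ := v.1 * w.1 + v.2 * w.2

/-- The hyperbolic length-type functional `L(u) = ((1/2π)∫₀^{2π} u₂⁻²|u'|² dt)^{1/2}`. -/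
def hypL (u : ℝ → ℝ × ℝ) : ℝ :=
  Real.sqrt ((1 / (2 * π)) * ∫ t in (0:ℝ)..(2 * π),
    ((deriv u t).1 ^ 2 + (deriv u t).2 ^ 2) / (u t).2 ^ 2)

/-- `u` is a `K`-loop in the upper half-plane model of the hyperbolic plane:
a nonconstant C² `2π`-periodic curve with values in `H²` solving
`u'' - u₂⁻¹ Γ(u') = L(u) K(u) iu'`. -/
def IsKLoop (K : (ℝ × ℝ) → ℝ) (u : ℝ → ℝ × ℝ) : Prop :=
  ContDiff ℝ 2 u ∧ Function.Periodic u (2 * π) ∧ (∀ t, 0 < (u t).2) ∧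
  (¬ ∃ c, ∀ t, u t = c) ∧
  ∀ t, deriv (deriv u) t - ((u t).2)⁻¹ • Gam (deriv u t)
      = (hypL u * K (u t)) • rot (deriv u t)

/-- A `2π`-periodic curve is embedded if it is injective modulo `2π`. -/
def IsEmbedded (u : ℝ → ℝ × ℝ) : Prop :=
  ∀ t s : ℝ, u t = u s → ∃ n : ℤ, t - s = 2 * π * (n : ℝ)

/-- `R_k = (k² - 1)^{-1/2}`. -/
def Rk (k : ℝ) : ℝ := 1 / Real.sqrt (k ^ 2 - 1)

/-- The reference loop `ω(t) = (cos t, 1/R_k) / (k - sin t)`, a parameterization of the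
hyperbolic circle of center `(0,1)` and hyperbolic radius `ρ_k = artanh(1/k)`. -/
def om (k : ℝ) (t : ℝ) : ℝ × ℝ := (cos t / (k - sin t), (1 / Rk k) / (k - sin t))

/-- The translated reference circle `ω_z(t) = (z₁ + z₂ω₁(t), z₂ω₂(t))`, a parameterization
of the hyperbolic circle of center `z` and hyperbolic radius `ρ_k`. -/
def omz (k : ℝ) (z : ℝ × ℝ) (t : ℝ) : ℝ × ℝ :=
  (z.1 + z.2 * (om k t).1, z.2 * (om k t).2)

/-- The Euclidean norm on `ℝ × ℝ`. -/
def enorm2 (w : ℝ × ℝ) : ℝ := Real.sqrt (w.1 ^ 2 + w.2 ^ 2)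

/-- The Euclidean open disk of center `c` and radius `r` in `ℝ × ℝ`. -/
def EBall (c : ℝ × ℝ) (r : ℝ) : Set (ℝ × ℝ) :=
  {p : ℝ × ℝ | (p.1 - c.1) ^ 2 + (p.2 - c.2) ^ 2 < r ^ 2}

/-- The Melnikov function `F_k^K(z) = ∫_{D^H_{ρ_k}(z)} K(p) p₂⁻² dp`, the disk
`D^H_{ρ_k}(z)` being the Euclidean disk of center `(z₁, kR_k z₂)` and radius `R_k z₂`. -/
def Fmel (k : ℝ) (K : (ℝ × ℝ) → ℝ) (z : ℝ × ℝ) : ℝ :=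
  ∫ p in EBall ((z.1, k * Rk k * z.2) : ℝ × ℝ) (Rk k * z.2), K p / p.2 ^ 2

/-- `X` has a stable critical point in the bounded open set `A`: some `C¹`-neighborhood of
`X` consists of functions having a critical point in `A`. -/
def HasStableCriticalPt (X : (ℝ × ℝ) → ℝ) (A : Set (ℝ × ℝ)) : Prop :=
  ∃ r > (0:ℝ), ∀ G : (ℝ × ℝ) → ℝ,
    (∃ U : Set (ℝ × ℝ), IsOpen U ∧ closure A ⊆ U ∧ ContDiffOn ℝ 1 G U) →
    (∀ z ∈ closure A, |G z - X z| + ‖fderiv ℝ G z - fderiv ℝ X z‖ < r) →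
    ∃ z ∈ A, fderiv ℝ G z = 0

/-! ### Zeros of small Lipschitz perturbations of a submersion -/

/-- If `Φ` has a surjective strict derivative at a zero `x₀`, then `Φ + ε • G` has a zero at
distance `O(|ε|)` from `x₀`, uniformly with respect to uniformly Lipschitz and bounded `G`. -/
lemma exists_zero_add_smul_of_surjective {X Y : Type*} [NormedAddCommGroup X] [NormedSpace ℝ X]
    [CompleteSpace X] [NormedAddCommGroup Y] [NormedSpace ℝ Y] [CompleteSpace Y]
    {Φ : X → Y} {Φ' : X →L[ℝ] Y} {x₀ : X} (hΦ : HasStrictFDerivAt Φ Φ' x₀)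
    (hsurj : Function.Surjective Φ') (h0 : Φ x₀ = 0) {r : ℝ} (hr : 0 < r) (C : NNReal) :
    ∃ ε₀ > (0 : ℝ), ∃ M > (0 : ℝ), ∀ G : X → Y,
      LipschitzOnWith C G (Metric.closedBall x₀ r) → ‖G x₀‖ ≤ C →
      ∀ ε : ℝ, |ε| ≤ ε₀ → ∃ x, ‖x - x₀‖ ≤ M * |ε| ∧ Φ x + ε • G x = 0 := by
  have hrange : Φ'.range = ⊤ := LinearMap.range_eq_top.2 hsurj
  set N := Φ'.nonlinearRightInverseOfSurjective hrange with hN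
  have hNpos : 0 < N.nnnorm := Φ'.nonlinearRightInverseOfSurjective_nnnorm_pos hrange
  have hc : 0 < N.nnnorm⁻¹ / 4 := by positivity
  obtain ⟨s, hs, happ⟩ := hΦ.approximates_deriv_on_nhds (Or.inr hc)
  obtain ⟨ρ, hρ, hρs⟩ := Metric.nhds_basis_closedBall.mem_iff.1 hs
  set M : ℝ := 2 * N.nnnorm * (C + 1) with hM
  have hMpos : 0 < M := by positivity
  refine ⟨min ((N.nnnorm : ℝ)⁻¹ / 4 / (C + 1)) (min ρ r / M), by positivity, M, hMpos, ?_⟩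
  intro G hG hG0 ε hε
  have hε1 : |ε| * (C + 1) ≤ (N.nnnorm : ℝ)⁻¹ / 4 :=
    (le_div_iff₀ (by positivity)).1 (hε.trans (min_le_left _ _))
  have hε2 : M * |ε| ≤ min ρ r := by
    rw [mul_comm]
    exact (le_div_iff₀ hMpos).1 (hε.trans (min_le_right _ _))
  set B := Metric.closedBall x₀ (M * |ε|) with hB
  have hBs : B ⊆ s := (Metric.closedBall_subset_closedBall (hε2.trans (min_le_left _ _))).trans hρs
  have hBr : B ⊆ Metric.closedBall x₀ r :=
    Metric.closedBall_subset_closedBall (hε2.trans (min_le_right _ _))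
  have happ' : ApproximatesLinearOn (fun x => Φ x + ε • G x) Φ' B
      (N.nnnorm⁻¹ / 4 + N.nnnorm⁻¹ / 4) := by
    intro x hx y hy
    have h1 := happ x (hBs hx) y (hBs hy)
    have h2 := hG.dist_le_mul x (hBr hx) y (hBr hy)
    rw [dist_eq_norm, dist_eq_norm] at h2
    have h3 : ‖ε • (G x - G y)‖ ≤ (N.nnnorm : ℝ)⁻¹ / 4 * ‖x - y‖ := by
      rw [norm_smul, Real.norm_eq_abs]
      calc |ε| * ‖G x - G y‖ ≤ |ε| * (C * ‖x - y‖) := by gcongr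
        _ ≤ (|ε| * (C + 1)) * ‖x - y‖ := by
          nlinarith [mul_nonneg (abs_nonneg ε) (norm_nonneg (x - y))]
        _ ≤ _ := by gcongr
    calc ‖Φ x + ε • G x - (Φ y + ε • G y) - Φ' (x - y)‖
        = ‖(Φ x - Φ y - Φ' (x - y)) + ε • (G x - G y)‖ := by
          congr 1; rw [smul_sub]; abel
      _ ≤ _ := norm_add_le _ _
      _ ≤ _ := by push_cast at h1 ⊢; linarith
  have hsur := happ'.surjOn_closedBall_of_nonlinearRightInverse N (ε := M * |ε|) (b := x₀)
    (by positivity) subset_rfl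
  have hmem : (0 : Y) ∈ Metric.closedBall (Φ x₀ + ε • G x₀)
      (((N.nnnorm : ℝ)⁻¹ - (N.nnnorm⁻¹ / 4 + N.nnnorm⁻¹ / 4 : NNReal)) * (M * |ε|)) := by
    rw [mem_closedBall_iff_norm', h0, zero_add, sub_zero, norm_smul, Real.norm_eq_abs]
    have hN0 : (0 : ℝ) < N.nnnorm := by exact_mod_cast hNpos
    have : ((N.nnnorm : ℝ)⁻¹ - (N.nnnorm⁻¹ / 4 + N.nnnorm⁻¹ / 4 : NNReal)) * (M * |ε|)
        = |ε| * (C + 1) := by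
      push_cast; rw [hM]; field_simp; ring
    rw [this]
    gcongr
    linarith
  obtain ⟨x, hx, hx0⟩ := hsur hmem
  exact ⟨x, by rwa [mem_closedBall_iff_norm] at hx, hx0⟩

/-! ### Continuous `2π`-periodic functions -/

instance fact_zero_lt_two_pi : Fact (0 < 2 * π) := ⟨Real.two_pi_pos⟩

/-- The Banach algebra of continuous real functions of period `2π`. -/
abbrev PerC : Type := C(AddCircle (2 * π), ℝ)

namespace PerC

/-- The value at a real point of a periodic function. -/
abbrev ev (f : PerC) (t : ℝ) : ℝ := f (t : AddCircle (2 * π))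

/-- Bundling of a continuous `2π`-periodic function. -/
def of (f : ℝ → ℝ) (hf : Continuous f) (hp : Function.Periodic f (2 * π)) : PerC where
  toFun := hp.lift
  continuous_toFun := continuous_coinduced_dom.2 hf

lemma ext_ev {f g : PerC} (h : ∀ t, f.ev t = g.ev t) : f = g := by
  ext x
  induction x using QuotientAddGroup.induction_on with
  | H t => exact h t

lemma continuous_ev (f : PerC) : Continuous f.ev := f.continuous.comp (AddCircle.continuous_mk' _)

lemma periodic_ev (f : PerC) : Function.Periodic f.ev (2 * π) := fun t => by
  simp [ev]

lemma abs_ev_le (f : PerC) (t : ℝ) : |f.ev t| ≤ ‖f‖ := f.norm_coe_le_norm _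

lemma norm_le_of_ev {f : PerC} {c : ℝ} (hc : 0 ≤ c) (h : ∀ t, |f.ev t| ≤ c) : ‖f‖ ≤ c := by
  refine (ContinuousMap.norm_le f hc).2 fun x => ?_
  induction x using QuotientAddGroup.induction_on with
  | H t => exact h t

lemma isUnit_of_ev_ne_zero {f : PerC} (h : ∀ t, f.ev t ≠ 0) : IsUnit f := by
  refine (ContinuousMap.isUnit_iff_forall_ne_zero f).2 fun x => ?_
  induction x using QuotientAddGroup.induction_on with
  | H t => exact h t

lemma inverse_ev {f : PerC} (h : ∀ t, f.ev t ≠ 0) (t : ℝ) :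
    ev (Ring.inverse f) t = (f.ev t)⁻¹ := by
  have h1 : ev (f * Ring.inverse f) t = 1 := by
    rw [Ring.mul_inverse_cancel f (isUnit_of_ev_ne_zero h)]; rfl
  exact (inv_eq_of_mul_eq_one_right h1).symm

lemma intervalIntegrable_ev (f : PerC) (a b : ℝ) : IntervalIntegrable f.ev volume a b :=
  f.continuous_ev.intervalIntegrable a b

/-- The mean value of a periodic function. -/
def mean : PerC →L[ℝ] ℝ :=
  LinearMap.mkContinuous
    { toFun := fun f => (1 / (2 * π)) * ∫ t in (0:ℝ)..(2 * π), f.ev t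
      map_add' := fun f g => by
        rw [← mul_add, ← intervalIntegral.integral_add (f.intervalIntegrable_ev _ _)
          (g.intervalIntegrable_ev _ _)]; rfl
      map_smul' := fun c f => by
        simp only [RingHom.id_apply, smul_eq_mul]
        rw [mul_left_comm, ← intervalIntegral.integral_const_mul c]; rfl } 1 (fun f => by
    have h := intervalIntegral.norm_integral_le_of_norm_le_const (a := 0) (b := 2 * π)
      (f := f.ev) (C := ‖f‖) (fun t _ => f.abs_ev_le t)
    have hπ := Real.pi_pos
    simp only [LinearMap.coe_mk, AddHom.coe_mk, norm_mul, one_mul]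
    rw [sub_zero, abs_of_pos Real.two_pi_pos] at h
    rw [Real.norm_of_nonneg (by positivity), one_div, inv_mul_le_iff₀ Real.two_pi_pos]
    linarith)

lemma mean_apply (f : PerC) : mean f = (1 / (2 * π)) * ∫ t in (0:ℝ)..(2 * π), f.ev t := rfl

lemma integral_eq_mean (f : PerC) : ∫ t in (0:ℝ)..(2 * π), f.ev t = 2 * π * mean f := by
  rw [mean_apply]; field_simp

lemma mean_one : mean 1 = 1 := by
  rw [mean_apply]; simp [ev]; field_simp

/-- `f'` is the derivative of `f`. -/
def IsDeriv (f f' : PerC) : Prop := ∀ t, HasDerivAt f.ev (f'.ev t) t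

lemma IsDeriv.mean_eq_zero {f f' : PerC} (h : IsDeriv f f') : mean f' = 0 := by
  rw [mean_apply, intervalIntegral.integral_eq_sub_of_hasDerivAt (fun t _ => h t)
    (f'.intervalIntegrable_ev _ _)]
  have := f.periodic_ev 0
  rw [zero_add] at this
  rw [this, sub_self, mul_zero]

lemma isDeriv_one : IsDeriv 1 0 := fun t => hasDerivAt_const t (1 : ℝ)

lemma IsDeriv.mul {f f' g g' : PerC} (hf : IsDeriv f f') (hg : IsDeriv g g') :
    IsDeriv (f * g) (f' * g + f * g') := fun t => (hf t).mul (hg t)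

lemma IsDeriv.add {f f' g g' : PerC} (hf : IsDeriv f f') (hg : IsDeriv g g') :
    IsDeriv (f + g) (f' + g') := fun t => (hf t).add (hg t)

lemma IsDeriv.sub {f f' g g' : PerC} (hf : IsDeriv f f') (hg : IsDeriv g g') :
    IsDeriv (f - g) (f' - g') := fun t => (hf t).sub (hg t)

lemma IsDeriv.smul {f f' : PerC} (c : ℝ) (hf : IsDeriv f f') :
    IsDeriv (c • f) (c • f') := fun t => (hf t).const_mul c

lemma isDeriv_of_tendsto {f f' : ℕ → PerC} {g g' : PerC} (h : ∀ n, IsDeriv (f n) (f' n))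
    (hf : Tendsto f atTop (𝓝 g)) (hf' : Tendsto f' atTop (𝓝 g')) : IsDeriv g g' := by
  refine hasDerivAt_of_tendstoUniformly (l := atTop) (f := fun n => (f n).ev)
    (f' := fun n => (f' n).ev) ?_ (.of_forall h) fun t => ?_
  · exact (ContinuousMap.tendsto_iff_tendstoUniformly.1 hf').comp _
  · exact ((continuous_eval_const (t : AddCircle (2 * π))).tendsto g).comp hf

/-- A continuous function with mean zero on a period has a periodic primitive. -/
lemma periodic_primitive {f : ℝ → ℝ} (hf : Continuous f) (hp : Function.Periodic f (2 * π))
    (h0 : ∫ t in (0:ℝ)..(2 * π), f t = 0) :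
    Function.Periodic (fun t => ∫ s in (0:ℝ)..t, f s) (2 * π) := by
  intro t
  have h := hp.intervalIntegral_add_eq t 0
  rw [zero_add, h0] at h
  simp only
  rw [← intervalIntegral.integral_add_adjacent_intervals (hf.intervalIntegrable 0 t)
    (hf.intervalIntegrable t _), h, add_zero]

lemma hasDerivAt_primitive {f : ℝ → ℝ} (hf : Continuous f) (t : ℝ) :
    HasDerivAt (fun t => ∫ s in (0:ℝ)..t, f s) (f t) t :=
  intervalIntegral.integral_hasDerivAt_right (hf.intervalIntegrable _ _)
    (hf.stronglyMeasurableAtFilter _ _) hf.continuousAt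

lemma exists_primitive {f : PerC} (h0 : mean f = 0) : ∃ F : PerC, IsDeriv F f ∧ mean F = 0 := by
  have h0' : ∫ t in (0:ℝ)..(2 * π), f.ev t = 0 := by rw [integral_eq_mean, h0, mul_zero]
  let F₀ : PerC := of (fun t => ∫ s in (0:ℝ)..t, f.ev s)
    (continuous_iff_continuousAt.2 fun t => (hasDerivAt_primitive f.continuous_ev t).continuousAt)
    (periodic_primitive f.continuous_ev f.periodic_ev h0')
  refine ⟨F₀ - mean F₀ • 1, fun t => ?_, by simp [mean_one]⟩
  exact (hasDerivAt_primitive f.continuous_ev t).sub_const (mean F₀ * 1)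

end PerC

/-- The Banach space of `C²` periodic functions, as triples `(f, f', f'')`. -/
def perC2 : Submodule ℝ (PerC × PerC × PerC) where
  carrier := {x | PerC.IsDeriv x.1 x.2.1 ∧ PerC.IsDeriv x.2.1 x.2.2}
  add_mem' := fun ha hb => ⟨ha.1.add hb.1, ha.2.add hb.2⟩
  zero_mem' := ⟨fun t => hasDerivAt_const t (0 : ℝ), fun t => hasDerivAt_const t (0 : ℝ)⟩
  smul_mem' := fun c _ hx => ⟨hx.1.smul c, hx.2.smul c⟩

lemma isClosed_perC2 : IsClosed (perC2 : Set (PerC × PerC × PerC)) := by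
  refine IsSeqClosed.isClosed fun x y hx hxy => ?_
  have h1 : Tendsto (fun n => (x n).1) atTop (𝓝 y.1) := (continuous_fst.tendsto _).comp hxy
  have h2 : Tendsto (fun n => (x n).2.1) atTop (𝓝 y.2.1) :=
    ((continuous_fst.comp continuous_snd).tendsto _).comp hxy
  have h3 : Tendsto (fun n => (x n).2.2) atTop (𝓝 y.2.2) :=
    ((continuous_snd.comp continuous_snd).tendsto _).comp hxy
  exact ⟨PerC.isDeriv_of_tendsto (fun n => (hx n).1) h1 h2,
    PerC.isDeriv_of_tendsto (fun n => (hx n).2) h2 h3⟩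

instance : CompleteSpace perC2 := isClosed_perC2.completeSpace_coe


namespace PerC

lemma mean_pos {f : PerC} (h : ∀ t, 0 < f.ev t) : 0 < mean f := by
  rw [mean_apply]
  have := intervalIntegral.intervalIntegral_pos_of_pos (f.intervalIntegrable_ev 0 (2 * π)) h
    Real.two_pi_pos
  have := Real.pi_pos
  positivity

/-- The cosine. -/
def cosP : PerC := of cos continuous_cos Real.cos_periodic

/-- The sine. -/
def sinP : PerC := of sin continuous_sin Real.sin_periodic

lemma isDeriv_cosP : IsDeriv cosP (-sinP) := fun t => Real.hasDerivAt_cos t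

lemma isDeriv_sinP : IsDeriv sinP cosP := fun t => Real.hasDerivAt_sin t

/-- A function orthogonal to `cos` and `sin` is of the form `h'' + h`. -/
lemma exists_harmonic_solution {r : PerC} (hc : mean (r * cosP) = 0) (hs : mean (r * sinP) = 0) :
    ∃ h h' h'' : PerC, IsDeriv h h' ∧ IsDeriv h' h'' ∧ h'' + h = r := by
  obtain ⟨C, hC, -⟩ := exists_primitive hc
  obtain ⟨S, hS, -⟩ := exists_primitive hs
  refine ⟨sinP * C - cosP * S, cosP * C + sinP * S, r - (sinP * C - cosP * S), fun t => ?_,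
    fun t => ?_, by ring⟩
  · refine ((isDeriv_sinP.mul hC).sub (isDeriv_cosP.mul hS) t).congr_deriv ?_
    change cos t * C.ev t + sin t * (r.ev t * cos t)
      - (-sin t * S.ev t + cos t * (r.ev t * sin t)) = cos t * C.ev t + sin t * S.ev t
    ring
  · refine ((isDeriv_cosP.mul hC).add (isDeriv_sinP.mul hS) t).congr_deriv ?_
    change -sin t * C.ev t + cos t * (r.ev t * cos t)
      + (cos t * S.ev t + sin t * (r.ev t * sin t)) = r.ev t - (sin t * C.ev t - cos t * S.ev t)
    linear_combination r.ev t * Real.sin_sq_add_cos_sq t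

end PerC

open PerC

/-! ### The reference loop -/

section Reference

variable {k : ℝ} (hk : 1 < k)

lemma sub_sin_pos (hk : 1 < k) (t : ℝ) : 0 < k - sin t := by linarith [Real.sin_le_one t]

lemma sqrt_sq_sub_one_pos (hk : 1 < k) : 0 < √(k ^ 2 - 1) := Real.sqrt_pos.2 (by nlinarith)

lemma sq_sqrt_sq_sub_one (hk : 1 < k) : √(k ^ 2 - 1) ^ 2 = k ^ 2 - 1 :=
  Real.sq_sqrt (by nlinarith)

/-- The function `1 / (k - sin t)`. -/
def recip : PerC := of (fun t => (k - sin t)⁻¹)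
  ((continuous_const.sub continuous_sin).inv₀ fun t => (sub_sin_pos hk t).ne')
  (fun t => by simp only [Real.sin_add_two_pi])

/-- First coordinate of the reference loop. -/
def om1 : PerC := cosP * recip hk

/-- Second coordinate of the reference loop. -/
def om2 : PerC := √(k ^ 2 - 1) • recip hk

/-- First coordinate of the velocity of the reference loop. -/
def dom1 : PerC := (1 - k • sinP) * recip hk ^ 2

/-- Second coordinate of the velocity of the reference loop. -/
def dom2 : PerC := √(k ^ 2 - 1) • (cosP * recip hk ^ 2)

/-- First coordinate of the acceleration of the reference loop. -/
def ddom1 : PerC := (2 : ℝ) • (cosP * (1 - k • sinP) * recip hk ^ 3) - k • (cosP * recip hk ^ 2)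

/-- Second coordinate of the acceleration of the reference loop. -/
def ddom2 : PerC := √(k ^ 2 - 1) • ((2 : ℝ) • (cosP ^ 2 * recip hk ^ 3) - sinP * recip hk ^ 2)

lemma om1_ev (t : ℝ) : (om1 hk).ev t = cos t * (k - sin t)⁻¹ := rfl

lemma om2_ev (t : ℝ) : (om2 hk).ev t = √(k ^ 2 - 1) * (k - sin t)⁻¹ := rfl

lemma dom1_ev (t : ℝ) : (dom1 hk).ev t = (1 - k * sin t) * (k - sin t)⁻¹ ^ 2 := rfl

lemma dom2_ev (t : ℝ) : (dom2 hk).ev t = √(k ^ 2 - 1) * (cos t * (k - sin t)⁻¹ ^ 2) := rfl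

lemma ddom1_ev (t : ℝ) : (ddom1 hk).ev t =
    2 * (cos t * (1 - k * sin t) * (k - sin t)⁻¹ ^ 3) - k * (cos t * (k - sin t)⁻¹ ^ 2) := by
  rfl

lemma ddom2_ev (t : ℝ) : (ddom2 hk).ev t =
    √(k ^ 2 - 1) * (2 * (cos t ^ 2 * (k - sin t)⁻¹ ^ 3) - sin t * (k - sin t)⁻¹ ^ 2) := by
  rfl

lemma om_eq (t : ℝ) : om k t = ((om1 hk).ev t, (om2 hk).ev t) := by
  simp [om, Rk, om1_ev, om2_ev, div_eq_mul_inv]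

lemma om2_ev_pos (t : ℝ) : 0 < (om2 hk).ev t :=
  mul_pos (sqrt_sq_sub_one_pos hk) (inv_pos.2 (sub_sin_pos hk t))

lemma isDeriv_recip : IsDeriv (recip hk) (cosP * recip hk ^ 2) := fun t => by
  refine (((Real.hasDerivAt_sin t).const_sub k).inv (sub_sin_pos hk t).ne').congr_deriv ?_
  change -(-cos t) / (k - sin t) ^ 2 = cos t * (k - sin t)⁻¹ ^ 2
  rw [neg_neg, div_eq_mul_inv, inv_pow]

lemma isDeriv_om1 : IsDeriv (om1 hk) (dom1 hk) := fun t => by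
  refine ((isDeriv_cosP.mul (isDeriv_recip hk)) t).congr_deriv ?_
  have := (sub_sin_pos hk t).ne'
  rw [dom1_ev]
  change -sin t * (k - sin t)⁻¹ + cos t * (cos t * (k - sin t)⁻¹ ^ 2) = _
  field_simp
  linear_combination Real.sin_sq_add_cos_sq t

lemma isDeriv_om2 : IsDeriv (om2 hk) (dom2 hk) := (isDeriv_recip hk).smul _

lemma isDeriv_recip_sq : IsDeriv (recip hk ^ 2) ((2 : ℝ) • (cosP * recip hk ^ 3)) := fun t => by
  rw [pow_two]
  refine ((isDeriv_recip hk).mul (isDeriv_recip hk) t).congr_deriv ?_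
  congr 1
  rw [two_smul]
  ring

lemma isDeriv_dom1 : IsDeriv (dom1 hk) (ddom1 hk) := fun t => by
  refine (((isDeriv_one.sub (isDeriv_sinP.smul k)).mul (isDeriv_recip_sq hk)) t).congr_deriv ?_
  congr 1
  simp only [ddom1, two_smul]
  ring_nf
  simp

lemma isDeriv_dom2 : IsDeriv (dom2 hk) (ddom2 hk) := fun t => by
  refine (((isDeriv_cosP.mul (isDeriv_recip_sq hk)).smul √(k ^ 2 - 1)) t).congr_deriv ?_
  congr 1
  simp only [ddom2, two_smul]
  ring_nf

lemma dom_sq_ev (t : ℝ) : (dom1 hk).ev t ^ 2 + (dom2 hk).ev t ^ 2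
    = (√(k ^ 2 - 1))⁻¹ ^ 2 * (om2 hk).ev t ^ 2 := by
  have h1 := (sub_sin_pos hk t).ne'
  have h2 := (sqrt_sq_sub_one_pos hk).ne'
  have h3 := sq_sqrt_sq_sub_one hk
  rw [dom1_ev, dom2_ev, om2_ev]
  field_simp
  linear_combination (k ^ 2 - 1) * Real.sin_sq_add_cos_sq t + cos t ^ 2 * h3

/-- The first component of the equation of the reference loop. -/
lemma ddom1_eq (t : ℝ) : (ddom1 hk).ev t =
    2 * (dom1 hk).ev t * (dom2 hk).ev t * ((om2 hk).ev t)⁻¹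
      - k * (√(k ^ 2 - 1))⁻¹ * (dom2 hk).ev t := by
  have h1 := (sub_sin_pos hk t).ne'
  have h2 := (sqrt_sq_sub_one_pos hk).ne'
  rw [ddom1_ev, dom1_ev, dom2_ev, om2_ev]
  field_simp

/-- The second component of the equation of the reference loop. -/
lemma ddom2_eq (t : ℝ) : (ddom2 hk).ev t =
    ((dom2 hk).ev t ^ 2 - (dom1 hk).ev t ^ 2) * ((om2 hk).ev t)⁻¹
      + k * (√(k ^ 2 - 1))⁻¹ * (dom1 hk).ev t := by
  have h1 := (sub_sin_pos hk t).ne'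
  have h2 := (sqrt_sq_sub_one_pos hk).ne'
  have h3 := sq_sqrt_sq_sub_one hk
  rw [ddom2_ev, dom1_ev, dom2_ev, om2_ev]
  field_simp
  linear_combination √(k ^ 2 - 1) ^ 2 * Real.sin_sq_add_cos_sq t + (1 - k * sin t) * h3

lemma mean_dom1 : mean (dom1 hk) = 0 := (isDeriv_om1 hk).mean_eq_zero

lemma mean_om1 : mean (om1 hk) = 0 := by
  let f : PerC := of (fun t => -Real.log (k - sin t))
    ((continuous_const.sub continuous_sin).log fun t => (sub_sin_pos hk t).ne').neg
    (fun t => by simp only [Real.sin_add_two_pi])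
  refine IsDeriv.mean_eq_zero (f := f) fun t => ?_
  refine (((Real.hasDerivAt_sin t).const_sub k).log (sub_sin_pos hk t).ne').neg.congr_deriv ?_
  rw [om1_ev]
  ring

lemma mean_om_mul_dom : mean (om1 hk * dom1 hk + om2 hk * dom2 hk) = 0 := by
  have h := (((isDeriv_om1 hk).mul (isDeriv_om1 hk)).add
    ((isDeriv_om2 hk).mul (isDeriv_om2 hk))).mean_eq_zero
  have h2 : dom1 hk * om1 hk + om1 hk * dom1 hk + (dom2 hk * om2 hk + om2 hk * dom2 hk)
      = (2 : ℝ) • (om1 hk * dom1 hk + om2 hk * dom2 hk) := by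
    rw [two_smul]; ring
  rw [h2, map_smul, smul_eq_mul] at h
  linarith

lemma mean_om_sq_pos : 0 < mean (om1 hk * om1 hk + om2 hk * om2 hk) := mean_pos fun t => by
  change 0 < (om1 hk).ev t * (om1 hk).ev t + (om2 hk).ev t * (om2 hk).ev t
  nlinarith [om2_ev_pos hk t, mul_self_nonneg ((om1 hk).ev t), mul_pos (om2_ev_pos hk t) (om2_ev_pos hk t)]

lemma dom_sq_ev_pos (t : ℝ) : 0 < (dom1 hk).ev t ^ 2 + (dom2 hk).ev t ^ 2 := by
  rw [dom_sq_ev]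
  have := sqrt_sq_sub_one_pos hk
  have := om2_ev_pos hk t
  positivity

lemma mean_dom_sq_pos : 0 < mean (dom1 hk * dom1 hk + dom2 hk * dom2 hk) := mean_pos fun t => by
  change 0 < (dom1 hk).ev t * (dom1 hk).ev t + (dom2 hk).ev t * (dom2 hk).ev t
  simpa only [pow_two] using dom_sq_ev_pos hk t

end Reference


lemma PerC.IsDeriv.inverse {f f' : PerC} (hf : IsDeriv f f') (h0 : ∀ t, f.ev t ≠ 0) :
    IsDeriv (Ring.inverse f) (-(f' * Ring.inverse f ^ 2)) := fun t => by
  have h1 : ev (Ring.inverse f) = fun t => (f.ev t)⁻¹ := funext (inverse_ev h0)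
  rw [h1]
  refine ((hf t).inv (h0 t)).congr_deriv ?_
  change _ = -(f'.ev t * ev (Ring.inverse f) t ^ 2)
  rw [inverse_ev h0, neg_div, div_eq_mul_inv, inv_pow]

/-! ### The linearized equation in the moving frame of the reference loop -/

/-- Pointwise expression of the linearized operator in the frame `(a, b)`, `(-b, a)`: first
component. -/
lemma frame_identity_fst {a b y κ l g g₁ g₂ h h₁ h₂ m a₁ b₁ a₂ b₂ : ℝ} (hy : y ≠ 0)
    (hl : a ^ 2 + b ^ 2 = l * y ^ 2)
    (ha₁ : a₁ = 2 * a * b * y⁻¹ - κ * b) (hb₁ : b₁ = (b ^ 2 - a ^ 2) * y⁻¹ + κ * a)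
    (ha₂ : a₂ = 2 * (a₁ * b * y⁻¹ + a * b₁ * y⁻¹ - a * b * (b * y⁻¹ ^ 2)) - κ * b₁)
    (hb₂ : b₂ = (2 * b * b₁ - 2 * a * a₁) * y⁻¹ - (b ^ 2 - a ^ 2) * (b * y⁻¹ ^ 2) + κ * a₁) :
    -(g₂ * a + 2 * g₁ * a₁ + g * a₂ - (h₂ * b + 2 * h₁ * b₁ + h * b₂))
      - y⁻¹ ^ 2 * (g * b + h * a) * (2 * (a * b))
      + y⁻¹ * (2 * ((g₁ * a + g * a₁ - (h₁ * b + h * b₁)) * b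
        + a * (g₁ * b + g * b₁ + (h₁ * a + h * a₁))))
      - κ * (g₁ * b + g * b₁ + (h₁ * a + h * a₁)) + κ ^ 2 * m * b
      = (-g₂ + κ * h₁) * a - (-h₂ - κ * g₁ + l * h - κ ^ 2 * m) * b := by
  subst ha₂ hb₂
  subst ha₁ hb₁
  field_simp
  linear_combination (-b * h) * hl

/-- Pointwise expression of the linearized operator in the frame `(a, b)`, `(-b, a)`: second
component. -/
lemma frame_identity_snd {a b y κ l g g₁ g₂ h h₁ h₂ m a₁ b₁ a₂ b₂ : ℝ} (hy : y ≠ 0)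
    (hl : a ^ 2 + b ^ 2 = l * y ^ 2)
    (ha₁ : a₁ = 2 * a * b * y⁻¹ - κ * b) (hb₁ : b₁ = (b ^ 2 - a ^ 2) * y⁻¹ + κ * a)
    (ha₂ : a₂ = 2 * (a₁ * b * y⁻¹ + a * b₁ * y⁻¹ - a * b * (b * y⁻¹ ^ 2)) - κ * b₁)
    (hb₂ : b₂ = (2 * b * b₁ - 2 * a * a₁) * y⁻¹ - (b ^ 2 - a ^ 2) * (b * y⁻¹ ^ 2) + κ * a₁) :
    -(g₂ * b + 2 * g₁ * b₁ + g * b₂ + (h₂ * a + 2 * h₁ * a₁ + h * a₂))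
      - y⁻¹ ^ 2 * (g * b + h * a) * (b ^ 2 - a ^ 2)
      + y⁻¹ * (2 * (b * (g₁ * b + g * b₁ + (h₁ * a + h * a₁))
        - a * (g₁ * a + g * a₁ - (h₁ * b + h * b₁))))
      + κ * (g₁ * a + g * a₁ - (h₁ * b + h * b₁)) - κ ^ 2 * m * a
      = (-g₂ + κ * h₁) * b + (-h₂ - κ * g₁ + l * h - κ ^ 2 * m) * a := by
  subst ha₂ hb₂
  subst ha₁ hb₁
  field_simp
  linear_combination (a * h) * hl

/-- Pointwise variation of the hyperbolic speed in the frame `(a, b)`, `(-b, a)`. -/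
lemma frame_identity_speed {a b y κ l g g₁ h h₁ a₁ b₁ : ℝ} (hy : y ≠ 0)
    (hl : a ^ 2 + b ^ 2 = l * y ^ 2)
    (ha₁ : a₁ = 2 * a * b * y⁻¹ - κ * b) (hb₁ : b₁ = (b ^ 2 - a ^ 2) * y⁻¹ + κ * a) :
    -(y⁻¹ ^ 3 * (g * b + h * a) * (a ^ 2 + b ^ 2))
      + y⁻¹ ^ 2 * (a * (g₁ * a + g * a₁ - (h₁ * b + h * b₁))
        + b * (g₁ * b + g * b₁ + (h₁ * a + h * a₁)))
      = l * (g₁ - κ * h) := by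
  subst ha₁ hb₁
  field_simp
  linear_combination y * (g₁ - κ * h) * hl

section Frame

variable {k : ℝ} (hk : 1 < k)

lemma om2_ev_ne_zero (t : ℝ) : (om2 hk).ev t ≠ 0 := (om2_ev_pos hk t).ne'

/-- First coordinate of the third derivative of the reference loop. -/
def dddom1 : PerC :=
  (2 : ℝ) • (ddom1 hk * dom2 hk * Ring.inverse (om2 hk) + dom1 hk * ddom2 hk * Ring.inverse (om2 hk)
    - dom1 hk * dom2 hk * (dom2 hk * Ring.inverse (om2 hk) ^ 2))
    - (k * (√(k ^ 2 - 1))⁻¹) • ddom2 hk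

/-- Second coordinate of the third derivative of the reference loop. -/
def dddom2 : PerC :=
  ((2 : ℝ) • (dom2 hk * ddom2 hk) - (2 : ℝ) • (dom1 hk * ddom1 hk)) * Ring.inverse (om2 hk)
    - (dom2 hk ^ 2 - dom1 hk ^ 2) * (dom2 hk * Ring.inverse (om2 hk) ^ 2)
    + (k * (√(k ^ 2 - 1))⁻¹) • ddom1 hk

lemma isDeriv_ddom1 : IsDeriv (ddom1 hk) (dddom1 hk) := by
  have h : ddom1 hk = (2 : ℝ) • (dom1 hk * dom2 hk * Ring.inverse (om2 hk))
      - (k * (√(k ^ 2 - 1))⁻¹) • dom2 hk := ext_ev fun t => by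
    rw [ddom1_eq, ← inverse_ev (om2_ev_ne_zero hk)]
    change _ = 2 * ((dom1 hk).ev t * (dom2 hk).ev t * ev (Ring.inverse (om2 hk)) t)
      - (k * (√(k ^ 2 - 1))⁻¹) * (dom2 hk).ev t
    ring
  intro t
  have h2 := ((((isDeriv_dom1 hk).mul (isDeriv_dom2 hk)).mul
    ((isDeriv_om2 hk).inverse (om2_ev_ne_zero hk))).smul 2).sub
    ((isDeriv_dom2 hk).smul (k * (√(k ^ 2 - 1))⁻¹)) t
  rw [← h] at h2
  refine h2.congr_deriv ?_
  congr 1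
  rw [dddom1]
  congr 2
  ring

lemma isDeriv_ddom2 : IsDeriv (ddom2 hk) (dddom2 hk) := by
  have h : ddom2 hk = (dom2 hk * dom2 hk - dom1 hk * dom1 hk) * Ring.inverse (om2 hk)
      + (k * (√(k ^ 2 - 1))⁻¹) • dom1 hk := ext_ev fun t => by
    rw [ddom2_eq, ← inverse_ev (om2_ev_ne_zero hk), pow_two, pow_two]
    rfl
  intro t
  have h2 := ((((isDeriv_dom2 hk).mul (isDeriv_dom2 hk)).sub
    ((isDeriv_dom1 hk).mul (isDeriv_dom1 hk))).mul
    ((isDeriv_om2 hk).inverse (om2_ev_ne_zero hk))).add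
    ((isDeriv_dom1 hk).smul (k * (√(k ^ 2 - 1))⁻¹)) t
  rw [← h] at h2
  refine h2.congr_deriv ?_
  congr 1
  rw [dddom2]
  congr 1
  simp only [two_smul]
  ring

end Frame

/-! ### The nonlinear operator -/

/-- Pairs of `C²` periodic functions together with three multipliers. -/
abbrev PlaneLoop : Type := perC2 × perC2 × ℝ × ℝ × ℝ

/-- The target of the nonlinear operator. -/
abbrev EqSpace : Type := PerC × PerC × ℝ × ℝ × ℝ

namespace PlaneLoop

/-- The first coordinate of the loop. -/
def pos1 (x : PlaneLoop) : PerC := x.1.1.1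

/-- The second coordinate of the loop. -/
def pos2 (x : PlaneLoop) : PerC := x.2.1.1.1

/-- The first coordinate of the velocity. -/
def vel1 (x : PlaneLoop) : PerC := x.1.1.2.1

/-- The second coordinate of the velocity. -/
def vel2 (x : PlaneLoop) : PerC := x.2.1.1.2.1

/-- The first coordinate of the acceleration. -/
def acc1 (x : PlaneLoop) : PerC := x.1.1.2.2

/-- The second coordinate of the acceleration. -/
def acc2 (x : PlaneLoop) : PerC := x.2.1.1.2.2

/-- The square of the hyperbolic speed. -/
def speedSq (x : PlaneLoop) : PerC := Ring.inverse (pos2 x) ^ 2 * (vel1 x ^ 2 + vel2 x ^ 2)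

/-- The functional `L`. -/
def len (x : PlaneLoop) : ℝ := √(mean (speedSq x))

variable {k : ℝ} (hk : 1 < k)

/-- The first component of the unperturbed equation with multipliers. -/
def eqn1 (x : PlaneLoop) : PerC :=
  -acc1 x + Ring.inverse (pos2 x) * ((2 : ℝ) • (vel1 x * vel2 x)) - (len x * k) • vel2 x
    - pos2 x ^ 2 * (x.2.2.1 • dom1 hk + x.2.2.2.1 • 1 + x.2.2.2.2 • om1 hk)

/-- The second component of the unperturbed equation with multipliers. -/
def eqn2 (x : PlaneLoop) : PerC :=
  -acc2 x + Ring.inverse (pos2 x) * (vel2 x ^ 2 - vel1 x ^ 2) + (len x * k) • vel1 x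
    - pos2 x ^ 2 * (x.2.2.1 • dom2 hk + x.2.2.2.2 • om2 hk)

/-- The unperturbed equation with multipliers, together with the orthogonality conditions. -/
def eqn (x : PlaneLoop) : EqSpace :=
  (eqn1 hk x, eqn2 hk x,
    mean ((pos1 x - om1 hk) * dom1 hk + (pos2 x - om2 hk) * dom2 hk),
    mean (pos1 x - om1 hk),
    mean ((pos1 x - om1 hk) * om1 hk + (pos2 x - om2 hk) * om2 hk))

/-- The reference loop with vanishing multipliers. -/
def ref : PlaneLoop :=
  (⟨(om1 hk, dom1 hk, ddom1 hk), isDeriv_om1 hk, isDeriv_dom1 hk⟩,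
    ⟨(om2 hk, dom2 hk, ddom2 hk), isDeriv_om2 hk, isDeriv_dom2 hk⟩, 0, 0, 0)

lemma contDiff_perC2_val : ContDiff ℝ 1 (fun x : perC2 => (x : PerC × PerC × PerC)) :=
  IsBoundedLinearMap.contDiff
    ⟨⟨fun _ _ => rfl, fun _ _ => rfl⟩, 1, one_pos, fun x => by rw [one_mul]; rfl⟩
lemma contDiff_fstJet : ContDiff ℝ 1 (fun x : PlaneLoop => x.1.1) :=
  contDiff_perC2_val.comp contDiff_fst
lemma contDiff_sndJet : ContDiff ℝ 1 (fun x : PlaneLoop => x.2.1.1) :=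
  contDiff_perC2_val.comp (contDiff_fst.comp contDiff_snd)
lemma contDiff_pos1 : ContDiff ℝ 1 pos1 := contDiff_fst.comp contDiff_fstJet
lemma contDiff_pos2 : ContDiff ℝ 1 pos2 := contDiff_fst.comp contDiff_sndJet
lemma contDiff_vel1 : ContDiff ℝ 1 vel1 :=
  contDiff_fst.comp (contDiff_snd.comp contDiff_fstJet)
lemma contDiff_vel2 : ContDiff ℝ 1 vel2 :=
  contDiff_fst.comp (contDiff_snd.comp contDiff_sndJet)
lemma contDiff_acc1 : ContDiff ℝ 1 acc1 :=
  contDiff_snd.comp (contDiff_snd.comp contDiff_fstJet)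
lemma contDiff_acc2 : ContDiff ℝ 1 acc2 :=
  contDiff_snd.comp (contDiff_snd.comp contDiff_sndJet)

lemma isUnit_om2 : IsUnit (om2 hk) := isUnit_of_ev_ne_zero (om2_ev_ne_zero hk)

lemma contDiffAt_inverse_pos2 : ContDiffAt ℝ 1 (fun x => Ring.inverse (pos2 x)) (ref hk) := by
  obtain ⟨v, hv⟩ := isUnit_om2 hk
  have h := contDiffAt_ringInverse ℝ (n := 1) v
  rw [hv] at h
  exact ContDiffAt.comp (ref hk) h contDiff_pos2.contDiffAt

lemma contDiffAt_speedSq : ContDiffAt ℝ 1 speedSq (ref hk) :=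
  ((contDiffAt_inverse_pos2 hk).pow 2).mul
    ((contDiff_vel1.contDiffAt.pow 2).add (contDiff_vel2.contDiffAt.pow 2))

lemma speedSq_ref : speedSq (ref hk) = ((√(k ^ 2 - 1))⁻¹ ^ 2) • (1 : PerC) := ext_ev fun t => by
  change ev (Ring.inverse (om2 hk)) t ^ 2 * ((dom1 hk).ev t ^ 2 + (dom2 hk).ev t ^ 2)
    = (√(k ^ 2 - 1))⁻¹ ^ 2 * 1
  rw [inverse_ev (om2_ev_ne_zero hk), dom_sq_ev]
  have := om2_ev_ne_zero hk t
  field_simp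

lemma mean_speedSq_ref : mean (speedSq (ref hk)) = (√(k ^ 2 - 1))⁻¹ ^ 2 := by
  rw [speedSq_ref, map_smul, mean_one, smul_eq_mul, mul_one]

lemma len_ref : len (ref hk) = (√(k ^ 2 - 1))⁻¹ := by
  rw [len, mean_speedSq_ref, Real.sqrt_sq (inv_nonneg.2 (Real.sqrt_nonneg _))]

lemma mean_speedSq_ref_ne_zero : mean (speedSq (ref hk)) ≠ 0 := by
  rw [mean_speedSq_ref]
  exact pow_ne_zero _ (inv_ne_zero (sqrt_sq_sub_one_pos hk).ne')

lemma contDiffAt_len : ContDiffAt ℝ 1 len (ref hk) :=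
  (ContDiffAt.comp (ref hk) mean.contDiff.contDiffAt (contDiffAt_speedSq hk)).sqrt
    (mean_speedSq_ref_ne_zero hk)

lemma contDiffAt_eqn : ContDiffAt ℝ 1 (eqn hk) (ref hk) := by
  have hi := contDiffAt_inverse_pos2 hk
  have hl := contDiffAt_len hk
  have hu1 := contDiff_pos1.contDiffAt (x := ref hk)
  have hu2 := contDiff_pos2.contDiffAt (x := ref hk)
  have hv1 := contDiff_vel1.contDiffAt (x := ref hk)
  have hv2 := contDiff_vel2.contDiffAt (x := ref hk)
  have ha1 := contDiff_acc1.contDiffAt (x := ref hk)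
  have ha2 := contDiff_acc2.contDiffAt (x := ref hk)
  unfold eqn eqn1 eqn2
  fun_prop

lemma eqn_ref : eqn hk (ref hk) = 0 := by
  have h1 : eqn1 hk (ref hk) = 0 := ext_ev fun t => by
    change -(ddom1 hk).ev t + ev (Ring.inverse (om2 hk)) t * (2 * ((dom1 hk).ev t * (dom2 hk).ev t))
      - len (ref hk) * k * (dom2 hk).ev t
      - (om2 hk).ev t ^ 2 * (0 * (dom1 hk).ev t + 0 * 1 + 0 * (om1 hk).ev t) = 0
    rw [inverse_ev (om2_ev_ne_zero hk), len_ref, ddom1_eq]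
    ring
  have h2 : eqn2 hk (ref hk) = 0 := ext_ev fun t => by
    change -(ddom2 hk).ev t + ev (Ring.inverse (om2 hk)) t * ((dom2 hk).ev t ^ 2 - (dom1 hk).ev t ^ 2)
      + len (ref hk) * k * (dom1 hk).ev t
      - (om2 hk).ev t ^ 2 * (0 * (dom2 hk).ev t + 0 * (om2 hk).ev t) = 0
    rw [inverse_ev (om2_ev_ne_zero hk), len_ref, ddom2_eq]
    ring
  have h3 : pos1 (ref hk) - om1 hk = 0 := sub_self _
  have h4 : pos2 (ref hk) - om2 hk = 0 := sub_self _
  rw [eqn, h1, h2, h3, h4]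
  simp only [zero_mul, add_zero, map_zero]
  rfl

end PlaneLoop


/-! ### Surjectivity of the linearized operator -/

namespace PlaneLoop

variable {k : ℝ} (hk : 1 < k)

/-- Half the derivative of `speedSq` at the reference loop. -/
def dSpeedSq (ξ : PlaneLoop) : PerC :=
  -(Ring.inverse (om2 hk) ^ 3 * pos2 ξ * (dom1 hk ^ 2 + dom2 hk ^ 2))
    + Ring.inverse (om2 hk) ^ 2 * (dom1 hk * vel1 ξ + dom2 hk * vel2 ξ)

lemma hasDerivAt_line {E : Type*} [NormedAddCommGroup E] [NormedSpace ℝ E] (x v : E) :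
    HasDerivAt (fun s : ℝ => x + s • v) v 0 := by
  simpa using ((hasDerivAt_id (0 : ℝ)).smul_const v).const_add x

lemma hasDerivAt_inverse_pos2 (ξ : PlaneLoop) :
    HasDerivAt (fun s : ℝ => Ring.inverse (pos2 (ref hk + s • ξ)))
      (-(Ring.inverse (om2 hk) * pos2 ξ * Ring.inverse (om2 hk))) 0 := by
  obtain ⟨v, hv⟩ := isUnit_om2 hk
  have h := hasFDerivAt_ringInverse (𝕜 := ℝ) v
  have h2 : HasDerivAt (fun s : ℝ => pos2 (ref hk + s • ξ)) (pos2 ξ) 0 :=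
    hasDerivAt_line (om2 hk) (pos2 ξ)
  have h3 : pos2 (ref hk + (0 : ℝ) • ξ) = v := by rw [zero_smul, add_zero, hv]; rfl
  rw [← h3] at h
  have h4 := h.comp_hasDerivAt (0 : ℝ) h2
  rw [← hv, Ring.inverse_unit]
  refine h4.congr_deriv ?_
  simp

lemma hasDerivAt_speedSq (ξ : PlaneLoop) :
    HasDerivAt (fun s : ℝ => speedSq (ref hk + s • ξ)) ((2 : ℝ) • dSpeedSq hk ξ) 0 := by
  have hi := hasDerivAt_inverse_pos2 hk ξ
  have h1 : HasDerivAt (fun s : ℝ => vel1 (ref hk + s • ξ)) (vel1 ξ) 0 :=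
    hasDerivAt_line (dom1 hk) (vel1 ξ)
  have h2 : HasDerivAt (fun s : ℝ => vel2 (ref hk + s • ξ)) (vel2 ξ) 0 :=
    hasDerivAt_line (dom2 hk) (vel2 ξ)
  refine ((hi.pow 2).mul ((h1.pow 2).add (h2.pow 2))).congr_deriv ?_
  have e1 : pos2 (ref hk) = om2 hk := rfl
  have e2 : vel1 (ref hk) = dom1 hk := rfl
  have e3 : vel2 (ref hk) = dom2 hk := rfl
  simp only [zero_smul, add_zero, e1, e2, e3, dSpeedSq, two_smul]
  push_cast
  simp only [Pi.pow_apply, Pi.add_apply, zero_smul, add_zero, e1, e2, e3]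
  ring

lemma hasDerivAt_len (ξ : PlaneLoop) :
    HasDerivAt (fun s : ℝ => len (ref hk + s • ξ))
      (√(k ^ 2 - 1) * mean (dSpeedSq hk ξ)) 0 := by
  have h1 : HasDerivAt (fun s : ℝ => mean (speedSq (ref hk + s • ξ)))
      (mean ((2 : ℝ) • dSpeedSq hk ξ)) 0 :=
    (mean.hasFDerivAt).comp_hasDerivAt (0 : ℝ) (hasDerivAt_speedSq hk ξ)
  have h2 : mean (speedSq (ref hk + (0 : ℝ) • ξ)) ≠ 0 := by
    rw [zero_smul, add_zero]; exact mean_speedSq_ref_ne_zero hk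
  refine (h1.sqrt h2).congr_deriv ?_
  have h3 : √(mean (speedSq (ref hk + (0 : ℝ) • ξ))) = (√(k ^ 2 - 1))⁻¹ := by
    rw [zero_smul, add_zero]; exact len_ref hk
  rw [h3, map_smul, smul_eq_mul]
  have := (sqrt_sq_sub_one_pos hk).ne'
  field_simp

/-- The derivative of `eqn` at the reference loop. -/
def linEqn (ξ : PlaneLoop) : EqSpace :=
  (-acc1 ξ - Ring.inverse (om2 hk) ^ 2 * pos2 ξ * ((2 : ℝ) • (dom1 hk * dom2 hk))
      + Ring.inverse (om2 hk) * ((2 : ℝ) • (vel1 ξ * dom2 hk + dom1 hk * vel2 ξ))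
      - (k * (√(k ^ 2 - 1))⁻¹) • vel2 ξ - (k * (√(k ^ 2 - 1) * mean (dSpeedSq hk ξ))) • dom2 hk
      - om2 hk ^ 2 * (ξ.2.2.1 • dom1 hk + ξ.2.2.2.1 • 1 + ξ.2.2.2.2 • om1 hk),
    -acc2 ξ - Ring.inverse (om2 hk) ^ 2 * pos2 ξ * (dom2 hk ^ 2 - dom1 hk ^ 2)
      + Ring.inverse (om2 hk) * ((2 : ℝ) • (dom2 hk * vel2 ξ - dom1 hk * vel1 ξ))
      + (k * (√(k ^ 2 - 1))⁻¹) • vel1 ξ + (k * (√(k ^ 2 - 1) * mean (dSpeedSq hk ξ))) • dom1 hk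
      - om2 hk ^ 2 * (ξ.2.2.1 • dom2 hk + ξ.2.2.2.2 • om2 hk),
    mean (pos1 ξ * dom1 hk + pos2 ξ * dom2 hk), mean (pos1 ξ),
    mean (pos1 ξ * om1 hk + pos2 ξ * om2 hk))

lemma hasLineDerivAt_eqn (ξ : PlaneLoop) :
    HasLineDerivAt ℝ (eqn hk) (linEqn hk ξ) (ref hk) ξ := by
  have hi := hasDerivAt_inverse_pos2 hk ξ
  have hl := hasDerivAt_len hk ξ
  have hu1 : HasDerivAt (fun s : ℝ => pos1 (ref hk + s • ξ)) (pos1 ξ) 0 :=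
    hasDerivAt_line (om1 hk) (pos1 ξ)
  have hu2 : HasDerivAt (fun s : ℝ => pos2 (ref hk + s • ξ)) (pos2 ξ) 0 :=
    hasDerivAt_line (om2 hk) (pos2 ξ)
  have hv1 : HasDerivAt (fun s : ℝ => vel1 (ref hk + s • ξ)) (vel1 ξ) 0 :=
    hasDerivAt_line (dom1 hk) (vel1 ξ)
  have hv2 : HasDerivAt (fun s : ℝ => vel2 (ref hk + s • ξ)) (vel2 ξ) 0 :=
    hasDerivAt_line (dom2 hk) (vel2 ξ)
  have ha1 : HasDerivAt (fun s : ℝ => acc1 (ref hk + s • ξ)) (acc1 ξ) 0 :=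
    hasDerivAt_line (ddom1 hk) (acc1 ξ)
  have ha2 : HasDerivAt (fun s : ℝ => acc2 (ref hk + s • ξ)) (acc2 ξ) 0 :=
    hasDerivAt_line (ddom2 hk) (acc2 ξ)
  have hθ0 : HasDerivAt (fun s : ℝ => (ref hk + s • ξ).2.2.1) ξ.2.2.1 0 :=
    hasDerivAt_line (0 : ℝ) ξ.2.2.1
  have hθ1 : HasDerivAt (fun s : ℝ => (ref hk + s • ξ).2.2.2.1) ξ.2.2.2.1 0 :=
    hasDerivAt_line (0 : ℝ) ξ.2.2.2.1
  have hθ2 : HasDerivAt (fun s : ℝ => (ref hk + s • ξ).2.2.2.2) ξ.2.2.2.2 0 :=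
    hasDerivAt_line (0 : ℝ) ξ.2.2.2.2
  have e1 : pos2 (ref hk) = om2 hk := rfl
  have e2 : vel1 (ref hk) = dom1 hk := rfl
  have e3 : vel2 (ref hk) = dom2 hk := rfl
  have e4 : (ref hk).2.2.1 = 0 := rfl
  have e5 : (ref hk).2.2.2.1 = 0 := rfl
  have e6 : (ref hk).2.2.2.2 = 0 := rfl
  refine HasDerivAt.prodMk ?_ (HasDerivAt.prodMk ?_ (HasDerivAt.prodMk ?_
    (HasDerivAt.prodMk ?_ ?_)))
  · refine (((ha1.neg.add (hi.mul ((hv1.mul hv2).const_smul (2 : ℝ)))).sub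
      ((hl.mul_const k).smul hv2)).sub ((hu2.pow 2).mul
      (((hθ0.smul_const (dom1 hk)).add (hθ1.smul_const (1 : PerC))).add
        (hθ2.smul_const (om1 hk))))).congr_deriv ?_
    simp only [Pi.pow_apply, Pi.add_apply, Pi.mul_apply, Pi.smul_apply, zero_smul, add_zero,
      e1, e2, e3, e4, e5, e6, mul_zero, len_ref hk, zero_add]
    simp only [mul_comm k]
    ring
  · refine (((ha2.neg.add (hi.mul ((hv2.pow 2).sub (hv1.pow 2)))).add
      ((hl.mul_const k).smul hv1)).sub ((hu2.pow 2).mul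
      ((hθ0.smul_const (dom2 hk)).add (hθ2.smul_const (om2 hk))))).congr_deriv ?_
    simp only [Pi.pow_apply, Pi.add_apply, Pi.sub_apply, zero_smul,
      add_zero, e1, e2, e3, e4, e6, mul_zero, len_ref hk, zero_add]
    simp only [mul_comm k, two_smul]
    push_cast
    ring
  · exact mean.hasFDerivAt.comp_hasDerivAt (0 : ℝ)
      (((hu1.sub_const _).mul_const (dom1 hk)).add ((hu2.sub_const _).mul_const (dom2 hk)))
  · exact mean.hasFDerivAt.comp_hasDerivAt (0 : ℝ) (hu1.sub_const _)
  · exact mean.hasFDerivAt.comp_hasDerivAt (0 : ℝ)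
      (((hu1.sub_const _).mul_const (om1 hk)).add ((hu2.sub_const _).mul_const (om2 hk)))

lemma fderiv_eqn_apply (ξ : PlaneLoop) : fderiv ℝ (eqn hk) (ref hk) ξ = linEqn hk ξ :=
  (((contDiffAt_eqn hk).differentiableAt one_ne_zero).hasFDerivAt.hasLineDerivAt ξ).unique
    (hasLineDerivAt_eqn hk ξ)

end PlaneLoop


namespace PlaneLoop

variable {k : ℝ} (hk : 1 < k)

section FrameLoop

variable {g g₁ g₂ h h₁ h₂ : PerC} (hg : IsDeriv g g₁) (hg₁ : IsDeriv g₁ g₂)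
  (hh : IsDeriv h h₁) (hh₁ : IsDeriv h₁ h₂) (θ : ℝ × ℝ × ℝ)

/-- The variation `g ω' + h iω'` of the reference loop, with multipliers `θ`. -/
def frameLoop : PlaneLoop :=
  (⟨(g * dom1 hk - h * dom2 hk,
      g₁ * dom1 hk + g * ddom1 hk - (h₁ * dom2 hk + h * ddom2 hk),
      g₂ * dom1 hk + g₁ * ddom1 hk + (g₁ * ddom1 hk + g * dddom1 hk)
        - (h₂ * dom2 hk + h₁ * ddom2 hk + (h₁ * ddom2 hk + h * dddom2 hk))),
      (hg.mul (isDeriv_dom1 hk)).sub (hh.mul (isDeriv_dom2 hk)),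
      ((hg₁.mul (isDeriv_dom1 hk)).add (hg.mul (isDeriv_ddom1 hk))).sub
        ((hh₁.mul (isDeriv_dom2 hk)).add (hh.mul (isDeriv_ddom2 hk)))⟩,
    ⟨(g * dom2 hk + h * dom1 hk,
      g₁ * dom2 hk + g * ddom2 hk + (h₁ * dom1 hk + h * ddom1 hk),
      g₂ * dom2 hk + g₁ * ddom2 hk + (g₁ * ddom2 hk + g * dddom2 hk)
        + (h₂ * dom1 hk + h₁ * ddom1 hk + (h₁ * ddom1 hk + h * dddom1 hk))),
      (hg.mul (isDeriv_dom2 hk)).add (hh.mul (isDeriv_dom1 hk)),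
      ((hg₁.mul (isDeriv_dom2 hk)).add (hg.mul (isDeriv_ddom2 hk))).add
        ((hh₁.mul (isDeriv_dom1 hk)).add (hh.mul (isDeriv_ddom1 hk)))⟩, θ)

lemma inverse_om2_ev (t : ℝ) : ev (Ring.inverse (om2 hk)) t = ((om2 hk).ev t)⁻¹ :=
  inverse_ev (om2_ev_ne_zero hk) t

lemma dddom1_ev (t : ℝ) : (dddom1 hk).ev t =
    2 * ((ddom1 hk).ev t * (dom2 hk).ev t * ((om2 hk).ev t)⁻¹
      + (dom1 hk).ev t * (ddom2 hk).ev t * ((om2 hk).ev t)⁻¹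
      - (dom1 hk).ev t * (dom2 hk).ev t * ((dom2 hk).ev t * ((om2 hk).ev t)⁻¹ ^ 2))
      - k * (√(k ^ 2 - 1))⁻¹ * (ddom2 hk).ev t := by
  rw [← inverse_om2_ev]; rfl

lemma dddom2_ev (t : ℝ) : (dddom2 hk).ev t =
    (2 * (dom2 hk).ev t * (ddom2 hk).ev t - 2 * (dom1 hk).ev t * (ddom1 hk).ev t)
        * ((om2 hk).ev t)⁻¹
      - ((dom2 hk).ev t ^ 2 - (dom1 hk).ev t ^ 2) * ((dom2 hk).ev t * ((om2 hk).ev t)⁻¹ ^ 2)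
      + k * (√(k ^ 2 - 1))⁻¹ * (ddom1 hk).ev t := by
  rw [← inverse_om2_ev, mul_assoc 2, mul_assoc 2]; rfl

lemma mean_dSpeedSq_frameLoop :
    mean (dSpeedSq hk (frameLoop hk hg hg₁ hh hh₁ θ))
      = -((√(k ^ 2 - 1))⁻¹ ^ 2 * (k * (√(k ^ 2 - 1))⁻¹) * mean h) := by
  have h1 : dSpeedSq hk (frameLoop hk hg hg₁ hh hh₁ θ)
      = ((√(k ^ 2 - 1))⁻¹ ^ 2) • (g₁ - (k * (√(k ^ 2 - 1))⁻¹) • h) := ext_ev fun t => by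
    have := frame_identity_speed (g := g.ev t) (g₁ := g₁.ev t) (h := h.ev t) (h₁ := h₁.ev t)
      (om2_ev_ne_zero hk t) (dom_sq_ev hk t) (ddom1_eq hk t) (ddom2_eq hk t)
    rw [← inverse_om2_ev] at this
    exact this
  rw [h1, map_smul, map_sub, map_smul, hg.mean_eq_zero, smul_eq_mul, smul_eq_mul]
  ring

/-- The linearized operator in the moving frame. -/
lemma linEqn_frameLoop {p q : PerC} (hp : -g₂ + (k * (√(k ^ 2 - 1))⁻¹) • h₁ = p)
    (hq : -h₂ - (k * (√(k ^ 2 - 1))⁻¹) • g₁ + ((√(k ^ 2 - 1))⁻¹ ^ 2) • h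
      - ((k * (√(k ^ 2 - 1))⁻¹) ^ 2 * mean h) • 1 = q) :
    linEqn hk (frameLoop hk hg hg₁ hh hh₁ θ) =
      (p * dom1 hk - q * dom2 hk - om2 hk ^ 2 * (θ.1 • dom1 hk + θ.2.1 • 1 + θ.2.2 • om1 hk),
        p * dom2 hk + q * dom1 hk - om2 hk ^ 2 * (θ.1 • dom2 hk + θ.2.2 • om2 hk),
        mean ((g * dom1 hk - h * dom2 hk) * dom1 hk + (g * dom2 hk + h * dom1 hk) * dom2 hk),
        mean (g * dom1 hk - h * dom2 hk),
        mean ((g * dom1 hk - h * dom2 hk) * om1 hk + (g * dom2 hk + h * dom1 hk) * om2 hk)) := by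
  have hs := (sqrt_sq_sub_one_pos hk).ne'
  have hm : k * (√(k ^ 2 - 1) * mean (dSpeedSq hk (frameLoop hk hg hg₁ hh hh₁ θ)))
      = -((k * (√(k ^ 2 - 1))⁻¹) ^ 2 * mean h) := by
    rw [mean_dSpeedSq_frameLoop]
    field_simp
  refine Prod.ext (ext_ev fun t => ?_) (Prod.ext (ext_ev fun t => ?_) rfl)
  · have := frame_identity_fst (g := g.ev t) (g₁ := g₁.ev t) (g₂ := g₂.ev t) (h := h.ev t)
      (h₁ := h₁.ev t) (h₂ := h₂.ev t) (m := mean h)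
      (om2_ev_ne_zero hk t) (dom_sq_ev hk t) (ddom1_eq hk t) (ddom2_eq hk t)
      (dddom1_ev hk t) (dddom2_ev hk t)
    rw [← inverse_om2_ev] at this
    rw [linEqn, hm, ← hp, ← hq]
    change -(g₂.ev t * (dom1 hk).ev t + g₁.ev t * (ddom1 hk).ev t
        + (g₁.ev t * (ddom1 hk).ev t + g.ev t * (dddom1 hk).ev t)
        - (h₂.ev t * (dom2 hk).ev t + h₁.ev t * (ddom2 hk).ev t
        + (h₁.ev t * (ddom2 hk).ev t + h.ev t * (dddom2 hk).ev t)))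
      - ev (Ring.inverse (om2 hk)) t ^ 2 * (g.ev t * (dom2 hk).ev t + h.ev t * (dom1 hk).ev t)
        * (2 * ((dom1 hk).ev t * (dom2 hk).ev t))
      + ev (Ring.inverse (om2 hk)) t * (2 * ((g₁.ev t * (dom1 hk).ev t + g.ev t * (ddom1 hk).ev t
        - (h₁.ev t * (dom2 hk).ev t + h.ev t * (ddom2 hk).ev t)) * (dom2 hk).ev t
        + (dom1 hk).ev t * (g₁.ev t * (dom2 hk).ev t + g.ev t * (ddom2 hk).ev t
        + (h₁.ev t * (dom1 hk).ev t + h.ev t * (ddom1 hk).ev t))))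
      - k * (√(k ^ 2 - 1))⁻¹ * (g₁.ev t * (dom2 hk).ev t + g.ev t * (ddom2 hk).ev t
        + (h₁.ev t * (dom1 hk).ev t + h.ev t * (ddom1 hk).ev t))
      - -((k * (√(k ^ 2 - 1))⁻¹) ^ 2 * mean h) * (dom2 hk).ev t
      - (om2 hk).ev t ^ 2 * (θ.1 * (dom1 hk).ev t + θ.2.1 * 1 + θ.2.2 * (om1 hk).ev t)
      = (-g₂.ev t + k * (√(k ^ 2 - 1))⁻¹ * h₁.ev t) * (dom1 hk).ev t
      - (-h₂.ev t - k * (√(k ^ 2 - 1))⁻¹ * g₁.ev t + (√(k ^ 2 - 1))⁻¹ ^ 2 * h.ev t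
        - (k * (√(k ^ 2 - 1))⁻¹) ^ 2 * mean h * 1) * (dom2 hk).ev t
      - (om2 hk).ev t ^ 2 * (θ.1 * (dom1 hk).ev t + θ.2.1 * 1 + θ.2.2 * (om1 hk).ev t)
    linear_combination this
  · have := frame_identity_snd (g := g.ev t) (g₁ := g₁.ev t) (g₂ := g₂.ev t) (h := h.ev t)
      (h₁ := h₁.ev t) (h₂ := h₂.ev t) (m := mean h)
      (om2_ev_ne_zero hk t) (dom_sq_ev hk t) (ddom1_eq hk t) (ddom2_eq hk t)
      (dddom1_ev hk t) (dddom2_ev hk t)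
    rw [← inverse_om2_ev] at this
    rw [linEqn, hm, ← hp, ← hq]
    change -(g₂.ev t * (dom2 hk).ev t + g₁.ev t * (ddom2 hk).ev t
        + (g₁.ev t * (ddom2 hk).ev t + g.ev t * (dddom2 hk).ev t)
        + (h₂.ev t * (dom1 hk).ev t + h₁.ev t * (ddom1 hk).ev t
        + (h₁.ev t * (ddom1 hk).ev t + h.ev t * (dddom1 hk).ev t)))
      - ev (Ring.inverse (om2 hk)) t ^ 2 * (g.ev t * (dom2 hk).ev t + h.ev t * (dom1 hk).ev t)
        * ((dom2 hk).ev t ^ 2 - (dom1 hk).ev t ^ 2)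
      + ev (Ring.inverse (om2 hk)) t * (2 * ((dom2 hk).ev t * (g₁.ev t * (dom2 hk).ev t
        + g.ev t * (ddom2 hk).ev t + (h₁.ev t * (dom1 hk).ev t + h.ev t * (ddom1 hk).ev t))
        - (dom1 hk).ev t * (g₁.ev t * (dom1 hk).ev t + g.ev t * (ddom1 hk).ev t
        - (h₁.ev t * (dom2 hk).ev t + h.ev t * (ddom2 hk).ev t))))
      + k * (√(k ^ 2 - 1))⁻¹ * (g₁.ev t * (dom1 hk).ev t + g.ev t * (ddom1 hk).ev t
        - (h₁.ev t * (dom2 hk).ev t + h.ev t * (ddom2 hk).ev t))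
      + -((k * (√(k ^ 2 - 1))⁻¹) ^ 2 * mean h) * (dom1 hk).ev t
      - (om2 hk).ev t ^ 2 * (θ.1 * (dom2 hk).ev t + θ.2.2 * (om2 hk).ev t)
      = (-g₂.ev t + k * (√(k ^ 2 - 1))⁻¹ * h₁.ev t) * (dom2 hk).ev t
      + (-h₂.ev t - k * (√(k ^ 2 - 1))⁻¹ * g₁.ev t + (√(k ^ 2 - 1))⁻¹ ^ 2 * h.ev t
        - (k * (√(k ^ 2 - 1))⁻¹) ^ 2 * mean h * 1) * (dom1 hk).ev t
      - (om2 hk).ev t ^ 2 * (θ.1 * (dom2 hk).ev t + θ.2.2 * (om2 hk).ev t)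
    linear_combination this

end FrameLoop

/-- Solvability of the linearized equation in the moving frame. -/
lemma exists_frame_solution (hk : 1 < k) {p q : PerC} (hp : mean p = 0)
    (h1 : mean (p * (1 - k • sinP) - √(k ^ 2 - 1) • (q * cosP)) = 0)
    (h2 : mean (k • (p * cosP) - √(k ^ 2 - 1) • (q * sinP)) = 0) :
    ∃ g g₁ g₂ h h₁ h₂ : PerC, IsDeriv g g₁ ∧ IsDeriv g₁ g₂ ∧ IsDeriv h h₁ ∧ IsDeriv h₁ h₂ ∧
      -g₂ + (k * (√(k ^ 2 - 1))⁻¹) • h₁ = p ∧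
      -h₂ - (k * (√(k ^ 2 - 1))⁻¹) • g₁ + ((√(k ^ 2 - 1))⁻¹ ^ 2) • h
        - ((k * (√(k ^ 2 - 1))⁻¹) ^ 2 * mean h) • 1 = q := by
  have hs := (sqrt_sq_sub_one_pos hk).ne'
  have hs2 := sq_sqrt_sq_sub_one hk
  set s := √(k ^ 2 - 1) with hsdef
  obtain ⟨F, hF, hF0⟩ := exists_primitive hp
  have e1 : mean (p * (1 - k • sinP)) = k * mean (F * cosP) := by
    have := (hF.mul (isDeriv_one.sub (isDeriv_sinP.smul k))).mean_eq_zero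
    rw [map_add, zero_sub, mul_neg, mul_smul_comm, map_neg, map_smul, smul_eq_mul] at this
    linarith
  have e2 : mean (p * cosP) = mean (F * sinP) := by
    have := (hF.mul isDeriv_cosP).mean_eq_zero
    rw [map_add, mul_neg, map_neg] at this
    linarith
  rw [map_sub, e1, map_smul, smul_eq_mul] at h1
  rw [map_sub, map_smul, map_smul, e2, smul_eq_mul, smul_eq_mul] at h2
  obtain ⟨h, h₁, h₂, hh, hh₁, hr⟩ := exists_harmonic_solution
    (r := (k * s⁻¹) • F - q)
    (by
      rw [sub_mul, map_sub, smul_mul_assoc, map_smul, smul_eq_mul]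
      field_simp
      linarith)
    (by
      rw [sub_mul, map_sub, smul_mul_assoc, map_smul, smul_eq_mul]
      field_simp
      linarith)
  obtain ⟨g, hg, -⟩ := exists_primitive (f := (k * s⁻¹) • (h - mean h • 1) - F) (by
    rw [map_sub, map_smul, map_sub, map_smul, mean_one, hF0]; simp)
  refine ⟨g, _, (k * s⁻¹) • h₁ - p, h, h₁, h₂, hg, ?_, hh, hh₁, ?_, ?_⟩
  · have := ((hh.sub (isDeriv_one.smul (mean h))).smul (k * s⁻¹)).sub hF
    simpa using this
  · abel
  · have e3 : q = (k * s⁻¹) • F - (h₂ + h) := by rw [hr]; abel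
    rw [e3]
    have e4 : (k * s⁻¹) ^ 2 = 1 + s⁻¹ ^ 2 := by
      field_simp; linarith
    refine ext_ev fun t => ?_
    change -h₂.ev t - k * s⁻¹ * (k * s⁻¹ * (h.ev t - mean h * 1) - F.ev t) + s⁻¹ ^ 2 * h.ev t
      - (k * s⁻¹) ^ 2 * mean h * 1 = k * s⁻¹ * F.ev t - (h₂.ev t + h.ev t)
    linear_combination (-h.ev t) * e4

end PlaneLoop


namespace PlaneLoop

variable {k : ℝ} (hk : 1 < k)

lemma translation_frame_fst (t : ℝ) : (1 - k * sin t) * (dom1 hk).ev t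
    + √(k ^ 2 - 1) * cos t * (dom2 hk).ev t = 1 := by
  have h1 := (sub_sin_pos hk t).ne'
  rw [dom1_ev, dom2_ev]
  field_simp
  linear_combination cos t ^ 2 * sq_sqrt_sq_sub_one hk + (k ^ 2 - 1) * Real.sin_sq_add_cos_sq t

lemma translation_frame_snd (t : ℝ) : (1 - k * sin t) * (dom2 hk).ev t
    - √(k ^ 2 - 1) * cos t * (dom1 hk).ev t = 0 := by
  rw [dom1_ev, dom2_ev]
  ring

lemma dilation_frame_fst (t : ℝ) : k * cos t * (dom1 hk).ev t
    + √(k ^ 2 - 1) * sin t * (dom2 hk).ev t = (om1 hk).ev t := by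
  have h1 := (sub_sin_pos hk t).ne'
  rw [dom1_ev, dom2_ev, om1_ev]
  field_simp
  linear_combination cos t * sin t * sq_sqrt_sq_sub_one hk

lemma dilation_frame_snd (t : ℝ) : k * cos t * (dom2 hk).ev t
    - √(k ^ 2 - 1) * sin t * (dom1 hk).ev t = (om2 hk).ev t := by
  have h1 := (sub_sin_pos hk t).ne'
  rw [dom1_ev, dom2_ev, om2_ev]
  field_simp
  linear_combination √(k ^ 2 - 1) * k * Real.sin_sq_add_cos_sq t

lemma exists_linEqn_eq (f₁ f₂ : PerC) :
    ∃ ξ, (linEqn hk ξ).1 = f₁ ∧ (linEqn hk ξ).2.1 = f₂ := by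
  set i : PerC := Ring.inverse (om2 hk) with hi
  set n₀ := mean (dom1 hk * dom1 hk + dom2 hk * dom2 hk) with hn₀
  set n₂ := mean (om1 hk * om1 hk + om2 hk * om2 hk) with hn₂
  set θ₀ := -mean (i ^ 2 * (f₁ * dom1 hk + f₂ * dom2 hk)) / n₀ with hθ₀
  set θ₁ := -mean (i ^ 2 * f₁) with hθ₁
  set θ₂ := -mean (i ^ 2 * (f₁ * om1 hk + f₂ * om2 hk)) / n₂ with hθ₂
  have hn₀' : n₀ ≠ 0 := (mean_dom_sq_pos hk).ne'
  have hn₂' : n₂ ≠ 0 := (mean_om_sq_pos hk).ne'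
  set f₁' := f₁ + om2 hk ^ 2 * (θ₀ • dom1 hk + θ₁ • 1 + θ₂ • om1 hk) with hf₁'
  set f₂' := f₂ + om2 hk ^ 2 * (θ₀ • dom2 hk + θ₂ • om2 hk) with hf₂'
  have hu (t : ℝ) : i.ev t * (om2 hk).ev t = 1 := by
    rw [hi, inverse_om2_ev, inv_mul_cancel₀ (om2_ev_ne_zero hk t)]
  have m₀ : mean (i ^ 2 * (f₁' * dom1 hk + f₂' * dom2 hk)) = 0 := by
    have e : i ^ 2 * (f₁' * dom1 hk + f₂' * dom2 hk)
        = i ^ 2 * (f₁ * dom1 hk + f₂ * dom2 hk)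
          + (θ₀ • (dom1 hk * dom1 hk + dom2 hk * dom2 hk) + θ₁ • dom1 hk
            + θ₂ • (om1 hk * dom1 hk + om2 hk * dom2 hk)) := ext_ev fun t => by
      change i.ev t ^ 2 * ((f₁.ev t + (om2 hk).ev t ^ 2 * (θ₀ * (dom1 hk).ev t + θ₁ * 1
          + θ₂ * (om1 hk).ev t)) * (dom1 hk).ev t + (f₂.ev t + (om2 hk).ev t ^ 2 *
          (θ₀ * (dom2 hk).ev t + θ₂ * (om2 hk).ev t)) * (dom2 hk).ev t)
        = i.ev t ^ 2 * (f₁.ev t * (dom1 hk).ev t + f₂.ev t * (dom2 hk).ev t)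
          + (θ₀ * ((dom1 hk).ev t * (dom1 hk).ev t + (dom2 hk).ev t * (dom2 hk).ev t)
            + θ₁ * (dom1 hk).ev t
            + θ₂ * ((om1 hk).ev t * (dom1 hk).ev t + (om2 hk).ev t * (dom2 hk).ev t))
      linear_combination (i.ev t * (om2 hk).ev t + 1)
        * (θ₀ * ((dom1 hk).ev t * (dom1 hk).ev t + (dom2 hk).ev t * (dom2 hk).ev t)
            + θ₁ * (dom1 hk).ev t
            + θ₂ * ((om1 hk).ev t * (dom1 hk).ev t + (om2 hk).ev t * (dom2 hk).ev t)) * hu t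
    rw [e, map_add, map_add, map_add, map_smul, map_smul, map_smul, mean_om_mul_dom, mean_dom1,
      ← hn₀, smul_zero, smul_zero, smul_eq_mul, hθ₀, div_mul_cancel₀ _ hn₀']
    ring
  have m₁ : mean (i ^ 2 * f₁') = 0 := by
    have e : i ^ 2 * f₁' = i ^ 2 * f₁ + (θ₀ • dom1 hk + θ₁ • 1 + θ₂ • om1 hk) :=
      ext_ev fun t => by
        change i.ev t ^ 2 * (f₁.ev t + (om2 hk).ev t ^ 2 * (θ₀ * (dom1 hk).ev t + θ₁ * 1
            + θ₂ * (om1 hk).ev t))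
          = i.ev t ^ 2 * f₁.ev t + (θ₀ * (dom1 hk).ev t + θ₁ * 1 + θ₂ * (om1 hk).ev t)
        linear_combination (i.ev t * (om2 hk).ev t + 1)
          * (θ₀ * (dom1 hk).ev t + θ₁ * 1 + θ₂ * (om1 hk).ev t) * hu t
    rw [e, map_add, map_add, map_add, map_smul, map_smul, map_smul, mean_one, mean_dom1,
      mean_om1, smul_zero, smul_zero, smul_eq_mul, hθ₁]
    ring
  have m₂ : mean (i ^ 2 * (f₁' * om1 hk + f₂' * om2 hk)) = 0 := by
    have e : i ^ 2 * (f₁' * om1 hk + f₂' * om2 hk)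
        = i ^ 2 * (f₁ * om1 hk + f₂ * om2 hk)
          + (θ₀ • (om1 hk * dom1 hk + om2 hk * dom2 hk) + θ₁ • om1 hk
            + θ₂ • (om1 hk * om1 hk + om2 hk * om2 hk)) := ext_ev fun t => by
      change i.ev t ^ 2 * ((f₁.ev t + (om2 hk).ev t ^ 2 * (θ₀ * (dom1 hk).ev t + θ₁ * 1
          + θ₂ * (om1 hk).ev t)) * (om1 hk).ev t + (f₂.ev t + (om2 hk).ev t ^ 2 *
          (θ₀ * (dom2 hk).ev t + θ₂ * (om2 hk).ev t)) * (om2 hk).ev t)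
        = i.ev t ^ 2 * (f₁.ev t * (om1 hk).ev t + f₂.ev t * (om2 hk).ev t)
          + (θ₀ * ((om1 hk).ev t * (dom1 hk).ev t + (om2 hk).ev t * (dom2 hk).ev t)
            + θ₁ * (om1 hk).ev t
            + θ₂ * ((om1 hk).ev t * (om1 hk).ev t + (om2 hk).ev t * (om2 hk).ev t))
      linear_combination (i.ev t * (om2 hk).ev t + 1)
        * (θ₀ * ((om1 hk).ev t * (dom1 hk).ev t + (om2 hk).ev t * (dom2 hk).ev t)
            + θ₁ * (om1 hk).ev t
            + θ₂ * ((om1 hk).ev t * (om1 hk).ev t + (om2 hk).ev t * (om2 hk).ev t)) * hu t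
    rw [e, map_add, map_add, map_add, map_smul, map_smul, map_smul, mean_om_mul_dom, mean_om1,
      ← hn₂, smul_zero, smul_zero, smul_eq_mul, hθ₂, div_mul_cancel₀ _ hn₂']
    ring
  set p : PerC := (√(k ^ 2 - 1) ^ 2) • (i ^ 2 * (f₁' * dom1 hk + f₂' * dom2 hk)) with hp
  set q : PerC := (√(k ^ 2 - 1) ^ 2) • (i ^ 2 * (f₂' * dom1 hk - f₁' * dom2 hk)) with hq
  have p₀ : mean p = 0 := by rw [hp, map_smul, m₀, smul_zero]
  have p₁ : mean (p * (1 - k • sinP) - √(k ^ 2 - 1) • (q * cosP)) = 0 := by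
    have e : p * (1 - k • sinP) - √(k ^ 2 - 1) • (q * cosP)
        = (√(k ^ 2 - 1) ^ 2) • (i ^ 2 * f₁') := ext_ev fun t => by
      change √(k ^ 2 - 1) ^ 2 * (i.ev t ^ 2 * (f₁'.ev t * (dom1 hk).ev t
          + f₂'.ev t * (dom2 hk).ev t)) * (1 - k * sin t)
        - √(k ^ 2 - 1) * (√(k ^ 2 - 1) ^ 2 * (i.ev t ^ 2 * (f₂'.ev t * (dom1 hk).ev t
          - f₁'.ev t * (dom2 hk).ev t)) * cos t) = √(k ^ 2 - 1) ^ 2 * (i.ev t ^ 2 * f₁'.ev t)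
      linear_combination √(k ^ 2 - 1) ^ 2 * i.ev t ^ 2 * (f₁'.ev t * translation_frame_fst hk t
        + f₂'.ev t * translation_frame_snd hk t)
    rw [e, map_smul, m₁, smul_zero]
  have p₂ : mean (k • (p * cosP) - √(k ^ 2 - 1) • (q * sinP)) = 0 := by
    have e : k • (p * cosP) - √(k ^ 2 - 1) • (q * sinP)
        = (√(k ^ 2 - 1) ^ 2) • (i ^ 2 * (f₁' * om1 hk + f₂' * om2 hk)) := ext_ev fun t => by
      change k * (√(k ^ 2 - 1) ^ 2 * (i.ev t ^ 2 * (f₁'.ev t * (dom1 hk).ev t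
          + f₂'.ev t * (dom2 hk).ev t)) * cos t)
        - √(k ^ 2 - 1) * (√(k ^ 2 - 1) ^ 2 * (i.ev t ^ 2 * (f₂'.ev t * (dom1 hk).ev t
          - f₁'.ev t * (dom2 hk).ev t)) * sin t)
        = √(k ^ 2 - 1) ^ 2 * (i.ev t ^ 2 * (f₁'.ev t * (om1 hk).ev t + f₂'.ev t * (om2 hk).ev t))
      linear_combination √(k ^ 2 - 1) ^ 2 * i.ev t ^ 2 * (f₁'.ev t * dilation_frame_fst hk t
        + f₂'.ev t * dilation_frame_snd hk t)
    rw [e, map_smul, m₂, smul_zero]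
  obtain ⟨g, g₁, g₂, h, h₁, h₂, hg, hg₁, hh, hh₁, hp', hq'⟩ := exists_frame_solution hk p₀ p₁ p₂
  refine ⟨frameLoop hk hg hg₁ hh hh₁ (θ₀, θ₁, θ₂), ?_⟩
  have hl (t : ℝ) : i.ev t ^ 2 * √(k ^ 2 - 1) ^ 2 * ((dom1 hk).ev t ^ 2 + (dom2 hk).ev t ^ 2)
      = 1 := by
    rw [dom_sq_ev, hi, inverse_om2_ev]
    have := om2_ev_ne_zero hk t
    have hs := (sqrt_sq_sub_one_pos hk).ne'
    field_simp
  rw [linEqn_frameLoop hk hg hg₁ hh hh₁ _ hp' hq']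
  constructor
  · refine ext_ev fun t => ?_
    change √(k ^ 2 - 1) ^ 2 * (i.ev t ^ 2 * (f₁'.ev t * (dom1 hk).ev t
          + f₂'.ev t * (dom2 hk).ev t)) * (dom1 hk).ev t
        - √(k ^ 2 - 1) ^ 2 * (i.ev t ^ 2 * (f₂'.ev t * (dom1 hk).ev t
          - f₁'.ev t * (dom2 hk).ev t)) * (dom2 hk).ev t
        - (om2 hk).ev t ^ 2 * (θ₀ * (dom1 hk).ev t + θ₁ * 1 + θ₂ * (om1 hk).ev t) = f₁.ev t
    have e : f₁'.ev t = f₁.ev t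
      + (om2 hk).ev t ^ 2 * (θ₀ * (dom1 hk).ev t + θ₁ * 1 + θ₂ * (om1 hk).ev t) := rfl
    linear_combination f₁'.ev t * hl t + e
  · refine ext_ev fun t => ?_
    change √(k ^ 2 - 1) ^ 2 * (i.ev t ^ 2 * (f₁'.ev t * (dom1 hk).ev t
          + f₂'.ev t * (dom2 hk).ev t)) * (dom2 hk).ev t
        + √(k ^ 2 - 1) ^ 2 * (i.ev t ^ 2 * (f₂'.ev t * (dom1 hk).ev t
          - f₁'.ev t * (dom2 hk).ev t)) * (dom1 hk).ev t
        - (om2 hk).ev t ^ 2 * (θ₀ * (dom2 hk).ev t + θ₂ * (om2 hk).ev t) = f₂.ev t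
    have e : f₂'.ev t = f₂.ev t
      + (om2 hk).ev t ^ 2 * (θ₀ * (dom2 hk).ev t + θ₂ * (om2 hk).ev t) := rfl
    linear_combination f₂'.ev t * hl t + e

/-- A variation satisfying the homogeneous linearized equation, with its moments. -/
lemma exists_linEqn_eq_of_frame {g g₁ g₂ h h₁ h₂ φ₁ φ₂ : PerC} (hg : IsDeriv g g₁)
    (hg₁ : IsDeriv g₁ g₂) (hh : IsDeriv h h₁) (hh₁ : IsDeriv h₁ h₂)
    (hφ₁ : g * dom1 hk - h * dom2 hk = φ₁) (hφ₂ : g * dom2 hk + h * dom1 hk = φ₂)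
    (hp : -g₂ + (k * (√(k ^ 2 - 1))⁻¹) • h₁ = 0)
    (hq : -h₂ - (k * (√(k ^ 2 - 1))⁻¹) • g₁ + ((√(k ^ 2 - 1))⁻¹ ^ 2) • h = 0)
    (hm : mean h = 0) :
    ∃ ξ, linEqn hk ξ = (0, 0, mean (φ₁ * dom1 hk + φ₂ * dom2 hk), mean φ₁,
      mean (φ₁ * om1 hk + φ₂ * om2 hk)) := by
  refine ⟨frameLoop hk hg hg₁ hh hh₁ 0, ?_⟩
  rw [linEqn_frameLoop hk hg hg₁ hh hh₁ 0 hp (q := 0) (by rw [hm, mul_zero, zero_smul, sub_zero, hq]),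
    hφ₁, hφ₂]
  simp

/-- Variations along the reference loop. -/
lemma exists_linEqn_eq_tangent :
    ∃ ξ, linEqn hk ξ = (0, 0, mean (dom1 hk * dom1 hk + dom2 hk * dom2 hk), 0, 0) := by
  have hz : IsDeriv 0 0 := fun t => hasDerivAt_const t (0 : ℝ)
  obtain ⟨ξ, hξ⟩ := exists_linEqn_eq_of_frame hk isDeriv_one hz hz hz (φ₁ := dom1 hk)
    (φ₂ := dom2 hk) (by simp) (by simp) (by simp) (by simp) (by simp)
  rw [mul_comm _ (om1 hk), mul_comm _ (om2 hk), mean_om_mul_dom, mean_dom1] at hξ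
  exact ⟨ξ, hξ⟩

lemma isDeriv_neg_sinP : IsDeriv (-sinP) (-cosP) := fun t => (Real.hasDerivAt_sin t).neg

/-- Horizontal translations. -/
lemma exists_linEqn_eq_translation : ∃ ξ, linEqn hk ξ = (0, 0, 0, 1, 0) := by
  have hs := (sqrt_sq_sub_one_pos hk).ne'
  have hs2 := sq_sqrt_sq_sub_one hk
  obtain ⟨ξ, hξ⟩ := exists_linEqn_eq_of_frame hk (isDeriv_one.sub (isDeriv_sinP.smul k))
    ((show IsDeriv 0 0 from fun t => hasDerivAt_const t (0 : ℝ)).sub (isDeriv_cosP.smul k))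
    (isDeriv_cosP.smul (-√(k ^ 2 - 1))) (isDeriv_neg_sinP.smul (-√(k ^ 2 - 1)))
    (φ₁ := 1) (φ₂ := 0)
    (ext_ev fun t => by
      change (1 - k * sin t) * (dom1 hk).ev t - -√(k ^ 2 - 1) * cos t * (dom2 hk).ev t = 1
      linear_combination translation_frame_fst hk t)
    (ext_ev fun t => by
      change (1 - k * sin t) * (dom2 hk).ev t + -√(k ^ 2 - 1) * cos t * (dom1 hk).ev t = 0
      linear_combination translation_frame_snd hk t)
    (ext_ev fun t => by
      change -(0 - k * -sin t) + k * (√(k ^ 2 - 1))⁻¹ * (-√(k ^ 2 - 1) * -sin t) = 0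
      field_simp
      ring)
    (ext_ev fun t => by
      change -(-√(k ^ 2 - 1) * -cos t) - k * (√(k ^ 2 - 1))⁻¹ * (0 - k * cos t)
        + (√(k ^ 2 - 1))⁻¹ ^ 2 * (-√(k ^ 2 - 1) * cos t) = 0
      field_simp
      linear_combination (-cos t) * hs2)
    (by rw [map_smul, isDeriv_sinP.mean_eq_zero, smul_zero])
  rw [one_mul, one_mul, zero_mul, zero_mul, add_zero, add_zero, mean_dom1, mean_om1, mean_one] at hξ
  exact ⟨ξ, hξ⟩

/-- Dilations. -/
lemma exists_linEqn_eq_dilation :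
    ∃ ξ, linEqn hk ξ = (0, 0, 0, 0, mean (om1 hk * om1 hk + om2 hk * om2 hk)) := by
  have hs := (sqrt_sq_sub_one_pos hk).ne'
  have hs2 := sq_sqrt_sq_sub_one hk
  obtain ⟨ξ, hξ⟩ := exists_linEqn_eq_of_frame hk (isDeriv_cosP.smul k) (isDeriv_neg_sinP.smul k)
    (isDeriv_sinP.smul (-√(k ^ 2 - 1))) (isDeriv_cosP.smul (-√(k ^ 2 - 1)))
    (φ₁ := om1 hk) (φ₂ := om2 hk)
    (ext_ev fun t => by
      change k * cos t * (dom1 hk).ev t - -√(k ^ 2 - 1) * sin t * (dom2 hk).ev t = (om1 hk).ev t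
      linear_combination dilation_frame_fst hk t)
    (ext_ev fun t => by
      change k * cos t * (dom2 hk).ev t + -√(k ^ 2 - 1) * sin t * (dom1 hk).ev t = (om2 hk).ev t
      linear_combination dilation_frame_snd hk t)
    (ext_ev fun t => by
      change -(k * -cos t) + k * (√(k ^ 2 - 1))⁻¹ * (-√(k ^ 2 - 1) * cos t) = 0
      field_simp
      ring)
    (ext_ev fun t => by
      change -(-√(k ^ 2 - 1) * -sin t) - k * (√(k ^ 2 - 1))⁻¹ * (k * -sin t)
        + (√(k ^ 2 - 1))⁻¹ ^ 2 * (-√(k ^ 2 - 1) * sin t) = 0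
      field_simp
      linear_combination (-sin t) * hs2)
    (by
      have := isDeriv_cosP.mean_eq_zero
      rw [map_neg, neg_eq_zero] at this
      rw [map_smul, this, smul_zero])
  rw [mean_om_mul_dom, mean_om1] at hξ
  exact ⟨ξ, hξ⟩

lemma surjective_fderiv_eqn : Function.Surjective (fderiv ℝ (eqn hk) (ref hk)) := by
  rintro ⟨f₁, f₂, c₀, c₁, c₂⟩
  obtain ⟨ξ, hξ₁, hξ₂⟩ := exists_linEqn_eq hk f₁ f₂
  obtain ⟨ξ₀, h₀⟩ := exists_linEqn_eq_tangent hk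
  obtain ⟨ξ₁, h₁⟩ := exists_linEqn_eq_translation hk
  obtain ⟨ξ₂, h₂⟩ := exists_linEqn_eq_dilation hk
  have hn₀ := (mean_dom_sq_pos hk).ne'
  have hn₂ := (mean_om_sq_pos hk).ne'
  refine ⟨ξ + ((c₀ - (linEqn hk ξ).2.2.1) / mean (dom1 hk * dom1 hk + dom2 hk * dom2 hk)) • ξ₀
    + (c₁ - (linEqn hk ξ).2.2.2.1) • ξ₁
    + ((c₂ - (linEqn hk ξ).2.2.2.2) / mean (om1 hk * om1 hk + om2 hk * om2 hk)) • ξ₂, ?_⟩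
  rw [map_add, map_add, map_add, map_smul, map_smul, map_smul]
  simp only [fderiv_eqn_apply, h₀, h₁, h₂, Prod.smul_mk, smul_zero, smul_eq_mul, mul_zero,
    mul_one, div_mul_cancel₀ _ hn₀, div_mul_cancel₀ _ hn₂]
  refine Prod.ext ?_ (Prod.ext ?_ (Prod.ext ?_ (Prod.ext ?_ ?_)))
  · simp [hξ₁]
  · simp [hξ₂]
  · simp
  · simp
  · simp

end PlaneLoop


/-! ### The perturbed equation -/

/-- The product of two bounded Lipschitz maps is Lipschitz. -/
lemma norm_mul_sub_mul_le {R : Type*} [NormedRing R] {f₁ f₂ g₁ g₂ : R} {a b A B d : ℝ}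
    (hf : ‖f₁ - f₂‖ ≤ a * d) (hg : ‖g₁ - g₂‖ ≤ b * d) (hA : ‖f₁‖ ≤ A) (hB : ‖g₂‖ ≤ B) :
    ‖f₁ * g₁ - f₂ * g₂‖ ≤ (A * b + a * B) * d := by
  have e : f₁ * g₁ - f₂ * g₂ = f₁ * (g₁ - g₂) + (f₁ - f₂) * g₂ := by noncomm_ring
  rw [e]
  calc _ ≤ ‖f₁ * (g₁ - g₂)‖ + ‖(f₁ - f₂) * g₂‖ := norm_add_le _ _
    _ ≤ ‖f₁‖ * ‖g₁ - g₂‖ + ‖f₁ - f₂‖ * ‖g₂‖ := add_le_add (norm_mul_le _ _) (norm_mul_le _ _)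
    _ ≤ A * (b * d) + (a * d) * B := by
        gcongr
        · exact (norm_nonneg _).trans hA
        · exact (norm_nonneg _).trans hf
    _ = _ := by ring

namespace PlaneLoop

lemma norm_fstJet_le (x : PlaneLoop) : ‖x.1.1‖ ≤ ‖x‖ := norm_fst_le x

lemma norm_sndJet_le (x : PlaneLoop) : ‖x.2.1.1‖ ≤ ‖x‖ := (norm_fst_le x.2).trans (norm_snd_le x)

lemma norm_pos1_le (x : PlaneLoop) : ‖pos1 x‖ ≤ ‖x‖ := (norm_fst_le _).trans (norm_fstJet_le x)

lemma norm_pos2_le (x : PlaneLoop) : ‖pos2 x‖ ≤ ‖x‖ := (norm_fst_le _).trans (norm_sndJet_le x)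

lemma norm_vel1_le (x : PlaneLoop) : ‖vel1 x‖ ≤ ‖x‖ :=
  (norm_fst_le _).trans ((norm_snd_le _).trans (norm_fstJet_le x))

lemma norm_vel2_le (x : PlaneLoop) : ‖vel2 x‖ ≤ ‖x‖ :=
  (norm_fst_le _).trans ((norm_snd_le _).trans (norm_sndJet_le x))

lemma norm_acc1_le (x : PlaneLoop) : ‖acc1 x‖ ≤ ‖x‖ :=
  (norm_snd_le _).trans ((norm_snd_le _).trans (norm_fstJet_le x))

lemma norm_acc2_le (x : PlaneLoop) : ‖acc2 x‖ ≤ ‖x‖ :=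
  (norm_snd_le _).trans ((norm_snd_le _).trans (norm_sndJet_le x))

/-- The loop moved to the base point `z`. -/
def curve (z : ℝ × ℝ) (x : PlaneLoop) (t : ℝ) : ℝ × ℝ :=
  (z.1 + z.2 * (pos1 x).ev t, z.2 * (pos2 x).ev t)

lemma continuous_curve (z : ℝ × ℝ) (x : PlaneLoop) : Continuous (curve z x) :=
  (continuous_const.add (continuous_const.mul (pos1 x).continuous_ev)).prodMk
    (continuous_const.mul (pos2 x).continuous_ev)

lemma periodic_curve (z : ℝ × ℝ) (x : PlaneLoop) : Function.Periodic (curve z x) (2 * π) :=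
  fun t => by simp only [curve, (pos1 x).periodic_ev t, (pos2 x).periodic_ev t]

variable {k : ℝ} (hk : 1 < k) {J : ℝ × ℝ → ℝ} {N : NNReal} (hJ : LipschitzWith N J)

/-- The function `J` along a loop. -/
def along (z : ℝ × ℝ) (x : PlaneLoop) : PerC :=
  of (fun t => J (curve z x t)) (hJ.continuous.comp (continuous_curve z x))
    ((periodic_curve z x).comp J)

lemma norm_curve_sub_le {z : ℝ × ℝ} {R : ℝ} (hz : ‖z‖ ≤ R) (x y : PlaneLoop) (t : ℝ) :
    ‖curve z x t - curve z y t‖ ≤ R * ‖x - y‖ := by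
  have hz2 : |z.2| ≤ R := (norm_snd_le z).trans hz
  have h1 : |(pos1 x).ev t - (pos1 y).ev t| ≤ ‖x - y‖ :=
    ((pos1 x - pos1 y).abs_ev_le t).trans (norm_pos1_le (x - y))
  have h2 : |(pos2 x).ev t - (pos2 y).ev t| ≤ ‖x - y‖ :=
    ((pos2 x - pos2 y).abs_ev_le t).trans (norm_pos2_le (x - y))
  refine max_le ?_ ?_
  · change |z.1 + z.2 * (pos1 x).ev t - (z.1 + z.2 * (pos1 y).ev t)| ≤ _
    rw [add_sub_add_left_eq_sub, ← mul_sub, abs_mul]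
    exact mul_le_mul hz2 h1 (abs_nonneg _) ((abs_nonneg _).trans hz2)
  · change |z.2 * (pos2 x).ev t - z.2 * (pos2 y).ev t| ≤ _
    rw [← mul_sub, abs_mul]
    exact mul_le_mul hz2 h2 (abs_nonneg _) ((abs_nonneg _).trans hz2)

lemma norm_curve_le {z : ℝ × ℝ} {R : ℝ} (hz : ‖z‖ ≤ R) (x : PlaneLoop) (t : ℝ) :
    ‖curve z x t‖ ≤ R + R * ‖x‖ := by
  have h := norm_curve_sub_le hz x 0 t
  have h0 : ‖curve z 0 t‖ ≤ R := by
    refine le_trans ?_ hz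
    have : curve z 0 t = (z.1, 0) := by
      change (z.1 + z.2 * 0, z.2 * 0) = _
      simp
    rw [this]
    exact max_le (norm_fst_le z) (by simp)
  rw [sub_zero] at h
  linarith [norm_le_norm_add_norm_sub (curve z 0 t) (curve z x t),
    norm_sub_rev (curve z 0 t) (curve z x t)]

lemma norm_along_sub_le {z : ℝ × ℝ} {R : ℝ} (hz : ‖z‖ ≤ R) (x y : PlaneLoop) :
    ‖along hJ z x - along hJ z y‖ ≤ (N * R) * ‖x - y‖ := by
  have hR := (norm_nonneg z).trans hz
  refine norm_le_of_ev (by positivity) fun t => ?_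
  change |J (curve z x t) - J (curve z y t)| ≤ _
  calc _ ≤ N * ‖curve z x t - curve z y t‖ := hJ.norm_sub_le _ _
    _ ≤ N * (R * ‖x - y‖) := by gcongr; exact norm_curve_sub_le hz x y t
    _ = _ := by ring

lemma norm_along_le {z : ℝ × ℝ} {R : ℝ} (hz : ‖z‖ ≤ R) (x : PlaneLoop) :
    ‖along hJ z x‖ ≤ |J 0| + N * (R + R * ‖x‖) := by
  have hR := (norm_nonneg z).trans hz
  refine norm_le_of_ev (by positivity) fun t => ?_
  change |J (curve z x t)| ≤ _
  have h1 : |J (curve z x t) - J 0| ≤ N * ‖curve z x t - 0‖ := hJ.norm_sub_le _ _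
  have h2 : N * ‖curve z x t‖ ≤ N * (R + R * ‖x‖) := by
    gcongr; exact norm_curve_le hz x t
  rw [sub_zero] at h1
  have h3 := abs_sub_abs_le_abs_sub (J (curve z x t)) (J 0)
  linarith

/-- The perturbation term of the equation. -/
def pert (z : ℝ × ℝ) (x : PlaneLoop) : EqSpace :=
  (-(along hJ z x * (len x • vel2 x)), along hJ z x * (len x • vel1 x), 0, 0, 0)

lemma exists_lipschitz_pert (R : ℝ) :
    ∃ r > 0, ∃ C : NNReal, ∀ z : ℝ × ℝ, ‖z‖ ≤ R →
      LipschitzOnWith C (pert hJ z) (Metric.closedBall (ref hk) r) ∧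
        ‖pert hJ z (ref hk)‖ ≤ C := by
  obtain ⟨C₁, s₁, hs₁, hC₁⟩ := ContDiffAt.exists_lipschitzOnWith
    ((contDiffAt_len hk).smul contDiff_vel1.contDiffAt)
  obtain ⟨C₂, s₂, hs₂, hC₂⟩ := ContDiffAt.exists_lipschitzOnWith
    ((contDiffAt_len hk).smul contDiff_vel2.contDiffAt)
  obtain ⟨r, hr, hrs⟩ := Metric.nhds_basis_closedBall.mem_iff.1 (inter_mem hs₁ hs₂)
  set A := |J 0| + N * (|R| + |R| * (‖ref hk‖ + r)) with hA
  set B₁ := ‖len (ref hk) • vel1 (ref hk)‖ + C₁ * r with hB₁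
  set B₂ := ‖len (ref hk) • vel2 (ref hk)‖ + C₂ * r with hB₂
  have hA0 : 0 ≤ A := by positivity
  have hB₁0 : 0 ≤ B₁ := by positivity
  have hB₂0 : 0 ≤ B₂ := by positivity
  set D₁ := A * C₁ + N * |R| * B₁ with hD₁
  set D₂ := A * C₂ + N * |R| * B₂ with hD₂
  have hD₁0 : 0 ≤ D₁ := by positivity
  have hD₂0 : 0 ≤ D₂ := by positivity
  refine ⟨r, hr, ⟨D₁ + D₂ + A * B₁ + A * B₂, by positivity⟩, fun z hz => ?_⟩
  have hz' : ‖z‖ ≤ |R| := hz.trans (le_abs_self R)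
  have hrefmem := Metric.mem_closedBall_self (x := ref hk) hr.le
  have b₀ : ∀ x ∈ Metric.closedBall (ref hk) r, ‖along hJ z x‖ ≤ A := fun x hx => by
    refine (norm_along_le hJ hz' x).trans ?_
    have : ‖x‖ ≤ ‖ref hk‖ + r := (norm_le_norm_add_norm_sub' x (ref hk)).trans
      (add_le_add le_rfl (mem_closedBall_iff_norm.1 hx))
    rw [hA]
    gcongr
  have b₁ : ∀ x ∈ Metric.closedBall (ref hk) r, ‖len x • vel1 x‖ ≤ B₁ := fun x hx => by
    have h1 := hC₁.norm_sub_le (hrs hx).1 (hrs hrefmem).1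
    have h2 : C₁ * ‖x - ref hk‖ ≤ C₁ * r := by gcongr; exact mem_closedBall_iff_norm.1 hx
    have h3 := norm_le_norm_add_norm_sub' (len x • vel1 x) (len (ref hk) • vel1 (ref hk))
    exact h3.trans (add_le_add le_rfl (h1.trans h2))
  have b₂ : ∀ x ∈ Metric.closedBall (ref hk) r, ‖len x • vel2 x‖ ≤ B₂ := fun x hx => by
    have h1 := hC₂.norm_sub_le (hrs hx).2 (hrs hrefmem).2
    have h2 : C₂ * ‖x - ref hk‖ ≤ C₂ * r := by gcongr; exact mem_closedBall_iff_norm.1 hx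
    have h3 := norm_le_norm_add_norm_sub' (len x • vel2 x) (len (ref hk) • vel2 (ref hk))
    exact h3.trans (add_le_add le_rfl (h1.trans h2))
  constructor
  · refine LipschitzOnWith.of_dist_le_mul fun x hx y hy => ?_
    rw [dist_eq_norm, dist_eq_norm]
    change _ ≤ (D₁ + D₂ + A * B₁ + A * B₂) * ‖x - y‖
    have h1 := norm_mul_sub_mul_le (norm_along_sub_le hJ hz' x y)
      (hC₁.norm_sub_le (hrs hx).1 (hrs hy).1) (b₀ x hx) (b₁ y hy)
    have h2 := norm_mul_sub_mul_le (norm_along_sub_le hJ hz' x y)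
      (hC₂.norm_sub_le (hrs hx).2 (hrs hy).2) (b₀ x hx) (b₂ y hy)
    have h3 : D₁ * ‖x - y‖ ≤ (D₁ + D₂ + A * B₁ + A * B₂) * ‖x - y‖ := by
      gcongr; nlinarith [mul_nonneg hA0 hB₁0, mul_nonneg hA0 hB₂0]
    have h4 : D₂ * ‖x - y‖ ≤ (D₁ + D₂ + A * B₁ + A * B₂) * ‖x - y‖ := by
      gcongr; nlinarith [mul_nonneg hA0 hB₁0, mul_nonneg hA0 hB₂0]
    have h0 : 0 ≤ (D₁ + D₂ + A * B₁ + A * B₂) * ‖x - y‖ := by positivity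
    refine max_le ?_ (max_le (h1.trans h3) ?_)
    · refine le_trans ?_ (h2.trans h4)
      rw [← norm_neg]
      apply le_of_eq
      congr 1
      change -(-(along hJ z x * (len x • vel2 x)) - -(along hJ z y * (len y • vel2 y))) = _
      abel
    · change ‖((0 : ℝ) - 0, (0 : ℝ) - 0, (0 : ℝ) - 0)‖ ≤ _
      simpa using h0
  · change _ ≤ D₁ + D₂ + A * B₁ + A * B₂
    have h1 := (norm_mul_le (along hJ z (ref hk)) (len (ref hk) • vel1 (ref hk))).trans
      (mul_le_mul (b₀ _ hrefmem) (b₁ _ hrefmem) (norm_nonneg _) hA0)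
    have h2 := (norm_mul_le (along hJ z (ref hk)) (len (ref hk) • vel2 (ref hk))).trans
      (mul_le_mul (b₀ _ hrefmem) (b₂ _ hrefmem) (norm_nonneg _) hA0)
    have h3 := mul_nonneg hA0 hB₁0
    have h4 := mul_nonneg hA0 hB₂0
    refine max_le ?_ (max_le ?_ ?_)
    · refine (norm_neg _).le.trans ?_
      linarith
    · change ‖along hJ z (ref hk) * (len (ref hk) • vel1 (ref hk))‖ ≤ _
      linarith
    · change ‖((0 : ℝ), (0 : ℝ), (0 : ℝ))‖ ≤ _
      simpa using by linarith

lemma exists_solution_pert (R : ℝ) :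
    ∃ ε₀ > 0, ∃ M > 0, ∀ z : ℝ × ℝ, ‖z‖ ≤ R → ∀ ε : ℝ, |ε| ≤ ε₀ →
      ∃ x, ‖x - ref hk‖ ≤ M * |ε| ∧ eqn hk x + ε • pert hJ z x = 0 := by
  obtain ⟨r, hr, C, hC⟩ := exists_lipschitz_pert hk hJ R
  obtain ⟨ε₀, hε₀, M, hM, h⟩ := exists_zero_add_smul_of_surjective
    ((contDiffAt_eqn hk).hasStrictFDerivAt one_ne_zero) (surjective_fderiv_eqn hk)
    (eqn_ref hk) hr C
  exact ⟨ε₀, hε₀, M, hM, fun z hz => h (pert hJ z) (hC z hz).1 (hC z hz).2⟩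

end PlaneLoop


/-! ### Properties of the loops near the reference loop -/

namespace PlaneLoop

lemma isDeriv_pos1 (x : PlaneLoop) : IsDeriv (pos1 x) (vel1 x) := x.1.2.1

lemma isDeriv_pos2 (x : PlaneLoop) : IsDeriv (pos2 x) (vel2 x) := x.2.1.2.1

lemma isDeriv_vel1 (x : PlaneLoop) : IsDeriv (vel1 x) (acc1 x) := x.1.2.2

lemma isDeriv_vel2 (x : PlaneLoop) : IsDeriv (vel2 x) (acc2 x) := x.2.1.2.2

variable {k : ℝ} (hk : 1 < k)

lemma om2_ev_ge (t : ℝ) : √(k ^ 2 - 1) * (k + 1)⁻¹ ≤ (om2 hk).ev t := by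
  rw [om2_ev]
  have := sub_sin_pos hk t
  have := Real.neg_one_le_sin t
  gcongr
  linarith

lemma pos2_ev_ge {x : PlaneLoop} (hx : ‖x - ref hk‖ ≤ √(k ^ 2 - 1) * (k + 1)⁻¹ / 2) (t : ℝ) :
    √(k ^ 2 - 1) * (k + 1)⁻¹ / 2 ≤ (pos2 x).ev t := by
  have h1 : |(pos2 x).ev t - (om2 hk).ev t| ≤ ‖x - ref hk‖ :=
    ((pos2 x - om2 hk).abs_ev_le t).trans (norm_pos2_le (x - ref hk))
  have h2 := om2_ev_ge hk t
  have h3 := (abs_le.1 (h1.trans hx)).1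
  linarith

lemma eventually_mean_dom_mul_vel_pos :
    ∀ᶠ x in 𝓝 (ref hk), 0 < mean (dom1 hk * vel1 x + dom2 hk * vel2 x) := by
  have hc : Continuous fun x => mean (dom1 hk * vel1 x + dom2 hk * vel2 x) :=
    mean.continuous.comp ((continuous_const.mul contDiff_vel1.continuous).add
      (continuous_const.mul contDiff_vel2.continuous))
  exact hc.continuousAt.eventually (lt_mem_nhds (mean_dom_sq_pos hk))

/-- The multiplier of `ω'` vanishes, by reparametrization invariance. -/
lemma multiplier_eq_zero {J : ℝ × ℝ → ℝ} {N : NNReal} (hJ : LipschitzWith N J) {z : ℝ × ℝ}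
    {ε : ℝ} {x : PlaneLoop} (hx : eqn hk x + ε • pert hJ z x = 0)
    (hpos : ∀ t, 0 < (pos2 x).ev t) (hm : 0 < mean (dom1 hk * vel1 x + dom2 hk * vel2 x)) :
    x.2.2.1 = 0 := by
  have h0 (t : ℝ) : (pos2 x).ev t ≠ 0 := (hpos t).ne'
  have hE₁ : eqn1 hk x + ε • (-(along hJ z x * (len x • vel2 x))) = 0 := congrArg (·.1) hx
  have hE₂ : eqn2 hk x + ε • (along hJ z x * (len x • vel1 x)) = 0 := congrArg (·.2.1) hx
  have hM : mean ((pos1 x - om1 hk) * dom1 hk + (pos2 x - om2 hk) * dom2 hk) + ε * 0 = 0 :=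
    congrArg (·.2.2.1) hx
  set i : PerC := Ring.inverse (pos2 x) with hi
  have hu (t : ℝ) : i.ev t * (pos2 x).ev t = 1 := by
    rw [hi, inverse_ev h0, inv_mul_cancel₀ (h0 t)]
  have hid := (isDeriv_pos2 x).inverse h0
  rw [← hi] at hid
  have d₁ := ((hid.mul hid).mul (((isDeriv_vel1 x).mul (isDeriv_vel1 x)).add
    ((isDeriv_vel2 x).mul (isDeriv_vel2 x)))).mean_eq_zero
  have d₂ := (((isDeriv_pos1 x).mul (isDeriv_om1 hk)).add
    ((isDeriv_pos2 x).mul (isDeriv_om2 hk))).mean_eq_zero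
  have d₃ := (isDeriv_pos1 x).mean_eq_zero
  have e₂ : mean (pos1 x * dom1 hk + pos2 x * dom2 hk) = 0 := by
    have e : (pos1 x - om1 hk) * dom1 hk + (pos2 x - om2 hk) * dom2 hk
        = pos1 x * dom1 hk + pos2 x * dom2 hk - (om1 hk * dom1 hk + om2 hk * dom2 hk) := by ring
    rw [e, map_sub, mean_om_mul_dom] at hM
    linarith
  have e₃ : mean (vel1 x * om1 hk + vel2 x * om2 hk) = 0 := by
    have e : vel1 x * om1 hk + pos1 x * dom1 hk + (vel2 x * om2 hk + pos2 x * dom2 hk)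
        = vel1 x * om1 hk + vel2 x * om2 hk + (pos1 x * dom1 hk + pos2 x * dom2 hk) := by ring
    rw [e, map_add, e₂, add_zero] at d₂
    exact d₂
  have key : (-(vel2 x * i ^ 2) * i + i * -(vel2 x * i ^ 2)) * (vel1 x * vel1 x + vel2 x * vel2 x)
      + i * i * (acc1 x * vel1 x + vel1 x * acc1 x + (acc2 x * vel2 x + vel2 x * acc2 x))
      = (-2 : ℝ) • (x.2.2.1 • (dom1 hk * vel1 x + dom2 hk * vel2 x) + x.2.2.2.1 • vel1 x
        + x.2.2.2.2 • (vel1 x * om1 hk + vel2 x * om2 hk)) := ext_ev fun t => by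
    have f₁ : -(acc1 x).ev t + i.ev t * (2 * ((vel1 x).ev t * (vel2 x).ev t))
        - len x * k * (vel2 x).ev t
        - (pos2 x).ev t ^ 2 * (x.2.2.1 * (dom1 hk).ev t + x.2.2.2.1 * 1
          + x.2.2.2.2 * (om1 hk).ev t)
        + ε * (-((along hJ z x).ev t * (len x * (vel2 x).ev t))) = 0 :=
      congrArg (fun f : PerC => f.ev t) hE₁
    have f₂ : -(acc2 x).ev t + i.ev t * ((vel2 x).ev t ^ 2 - (vel1 x).ev t ^ 2)
        + len x * k * (vel1 x).ev t
        - (pos2 x).ev t ^ 2 * (x.2.2.1 * (dom2 hk).ev t + x.2.2.2.2 * (om2 hk).ev t)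
        + ε * ((along hJ z x).ev t * (len x * (vel1 x).ev t)) = 0 :=
      congrArg (fun f : PerC => f.ev t) hE₂
    change (-((vel2 x).ev t * i.ev t ^ 2) * i.ev t + i.ev t * -((vel2 x).ev t * i.ev t ^ 2))
        * ((vel1 x).ev t * (vel1 x).ev t + (vel2 x).ev t * (vel2 x).ev t)
      + i.ev t * i.ev t * ((acc1 x).ev t * (vel1 x).ev t + (vel1 x).ev t * (acc1 x).ev t
        + ((acc2 x).ev t * (vel2 x).ev t + (vel2 x).ev t * (acc2 x).ev t))
      = -2 * (x.2.2.1 * ((dom1 hk).ev t * (vel1 x).ev t + (dom2 hk).ev t * (vel2 x).ev t)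
        + x.2.2.2.1 * (vel1 x).ev t
        + x.2.2.2.2 * ((vel1 x).ev t * (om1 hk).ev t + (vel2 x).ev t * (om2 hk).ev t))
    linear_combination (-2 * i.ev t ^ 2 * (vel1 x).ev t) * f₁
      + (-2 * i.ev t ^ 2 * (vel2 x).ev t) * f₂
      - 2 * (i.ev t * (pos2 x).ev t + 1)
        * (x.2.2.1 * ((dom1 hk).ev t * (vel1 x).ev t + (dom2 hk).ev t * (vel2 x).ev t)
        + x.2.2.2.1 * (vel1 x).ev t
        + x.2.2.2.2 * ((vel1 x).ev t * (om1 hk).ev t + (vel2 x).ev t * (om2 hk).ev t)) * hu t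
  rw [key, map_smul, map_add, map_add, map_smul, map_smul, map_smul, d₃, e₃, smul_zero, smul_zero,
    add_zero, add_zero, smul_eq_mul, smul_eq_mul] at d₁
  rcases mul_eq_zero.1 d₁ with h | h
  · norm_num at h
  · exact (mul_eq_zero.1 h).resolve_right hm.ne'

lemma exists_abs_sub_le_pi (t : ℝ) : ∃ n : ℤ, |t - 2 * π * n| ≤ π := by
  refine ⟨round (t / (2 * π)), ?_⟩
  have h := abs_sub_round (t / (2 * π))
  have hπ := Real.pi_pos
  have e : t - 2 * π * round (t / (2 * π)) = 2 * π * (t / (2 * π) - round (t / (2 * π))) := by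
    field_simp
  rw [e, abs_mul, abs_of_pos Real.two_pi_pos]
  nlinarith

lemma abs_ev_sub_ev_le {f f' : PerC} (h : IsDeriv f f') (t s : ℝ) :
    |f.ev t - f.ev s| ≤ ‖f'‖ * |t - s| :=
  Convex.norm_image_sub_le_of_norm_hasDerivWithin_le (s := Set.univ)
    (fun r _ => (h r).hasDerivWithinAt) (fun r _ => f'.abs_ev_le r) convex_univ
    (Set.mem_univ s) (Set.mem_univ t)

/-- The reference loop separates points, quantitatively. -/
lemma eq_of_abs_om_sub_le {t s η : ℝ} (hd : |t - s| ≤ π)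
    (h1 : |(om1 hk).ev t - (om1 hk).ev s| ≤ η * |t - s|)
    (h2 : |(om2 hk).ev t - (om2 hk).ev s| ≤ η * |t - s|)
    (hη : ((k + 1) + (1 + (k - 1)⁻¹) * ((k + 1) ^ 2 * (√(k ^ 2 - 1))⁻¹)) * η ≤ 1 / 4) : t = s := by
  have hS := sqrt_sq_sub_one_pos hk
  have ht := sub_sin_pos hk t
  have hs := sub_sin_pos hk s
  have hk1 : 0 < k - 1 := by linarith
  have bt : k - sin t ≤ k + 1 := by linarith [Real.neg_one_le_sin t]
  have bs : k - sin s ≤ k + 1 := by linarith [Real.neg_one_le_sin s]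
  set d := |t - s| with hdd
  have hd0 : 0 ≤ d := abs_nonneg _
  have e1 : sin t - sin s
      = (k - sin t) * (k - sin s) * (√(k ^ 2 - 1))⁻¹ * ((om2 hk).ev t - (om2 hk).ev s) := by
    rw [om2_ev, om2_ev]; field_simp; ring
  have e2 : cos t - cos s = (k - sin t) * ((om1 hk).ev t - (om1 hk).ev s)
      + (om1 hk).ev s * -(sin t - sin s) := by
    rw [om1_ev, om1_ev]; field_simp; ring
  have b1 : |sin t - sin s| ≤ (k + 1) ^ 2 * (√(k ^ 2 - 1))⁻¹ * (η * d) := by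
    rw [e1, abs_mul, abs_of_pos (by positivity), pow_two (k + 1)]
    gcongr
  have b0 : |(om1 hk).ev s| ≤ (k - 1)⁻¹ := by
    rw [om1_ev, abs_mul, abs_of_pos (inv_pos.2 hs)]
    have : (k - sin s)⁻¹ ≤ (k - 1)⁻¹ := by
      gcongr; exact Real.sin_le_one s
    calc _ ≤ 1 * (k - 1)⁻¹ := by gcongr; exact Real.abs_cos_le_one s
      _ = _ := one_mul _
  have b2 : |cos t - cos s| ≤ (k + 1) * (η * d)
      + (k - 1)⁻¹ * ((k + 1) ^ 2 * (√(k ^ 2 - 1))⁻¹ * (η * d)) := by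
    rw [e2]
    refine (abs_add_le _ _).trans ?_
    rw [abs_mul, abs_mul, abs_neg, abs_of_pos ht]
    gcongr
  have b3 : |sin t - sin s| + |cos t - cos s| ≤ 1 / 4 * d := by
    have := mul_le_mul_of_nonneg_right hη hd0
    linarith
  have b4 : (sin t - sin s) ^ 2 + (cos t - cos s) ^ 2 ≤ (1 / 4 * d) ^ 2 := by
    rw [← sq_abs (sin t - sin s), ← sq_abs (cos t - cos s)]
    nlinarith [abs_nonneg (sin t - sin s), abs_nonneg (cos t - cos s)]
  have b5 := Real.cos_le_one_sub_mul_cos_sq hd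
  rw [Real.cos_sub] at b5
  have hπ := Real.pi_pos
  have b6 : 1 / 8 ≤ 2 / π ^ 2 := by
    rw [div_le_div_iff₀ (by norm_num) (by positivity)]
    nlinarith [Real.pi_le_four]
  have b7 : 1 / 8 * (t - s) ^ 2 ≤ 2 / π ^ 2 * (t - s) ^ 2 := by gcongr
  rw [mul_pow, hdd, sq_abs] at b4
  have b8 : (t - s) ^ 2 ≤ 0 := by
    linarith [Real.sin_sq_add_cos_sq t, Real.sin_sq_add_cos_sq s]
  exact sub_eq_zero.1 (pow_eq_zero_iff two_ne_zero |>.1 (le_antisymm b8 (sq_nonneg _)))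

/-- Loops close to the reference loop are embedded. -/
lemma exists_injective_mod_period :
    ∃ η > 0, ∀ x, ‖x - ref hk‖ ≤ η → ∀ t s, (pos1 x).ev t = (pos1 x).ev s →
      (pos2 x).ev t = (pos2 x).ev s → ∃ n : ℤ, t - s = 2 * π * n := by
  have hS := sqrt_sq_sub_one_pos hk
  have hk1 : 0 < k - 1 := by linarith
  have hk2 : 0 < k + 1 := by linarith
  set Q := (k + 1) + (1 + (k - 1)⁻¹) * ((k + 1) ^ 2 * (√(k ^ 2 - 1))⁻¹) with hQ
  have hQ0 : 0 < Q := by positivity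
  refine ⟨1 / 4 / Q, by positivity, fun x hx t s h1 h2 => ?_⟩
  obtain ⟨n, hn⟩ := exists_abs_sub_le_pi (t - s)
  refine ⟨n, ?_⟩
  have hp (f : PerC) : f.ev (s + 2 * π * n) = f.ev s := by
    have := f.periodic_ev.int_mul n s
    rwa [mul_comm (n : ℝ)] at this
  rw [sub_sub] at hn
  have b1 := abs_ev_sub_ev_le ((isDeriv_pos1 x).sub (isDeriv_om1 hk)) t (s + 2 * π * n)
  have b2 := abs_ev_sub_ev_le ((isDeriv_pos2 x).sub (isDeriv_om2 hk)) t (s + 2 * π * n)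
  have c1 : ‖vel1 x - dom1 hk‖ ≤ 1 / 4 / Q := (norm_vel1_le (x - ref hk)).trans hx
  have c2 : ‖vel2 x - dom2 hk‖ ≤ 1 / 4 / Q := (norm_vel2_le (x - ref hk)).trans hx
  replace b1 := b1.trans (mul_le_mul_of_nonneg_right c1 (abs_nonneg _))
  replace b2 := b2.trans (mul_le_mul_of_nonneg_right c2 (abs_nonneg _))
  change |(pos1 x).ev t - (om1 hk).ev t - ((pos1 x).ev (s + 2 * π * n)
    - (om1 hk).ev (s + 2 * π * n))| ≤ _ at b1
  change |(pos2 x).ev t - (om2 hk).ev t - ((pos2 x).ev (s + 2 * π * n)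
    - (om2 hk).ev (s + 2 * π * n))| ≤ _ at b2
  rw [hp (pos1 x), h1, sub_sub_sub_cancel_left, abs_sub_comm] at b1
  rw [hp (pos2 x), h2, sub_sub_sub_cancel_left, abs_sub_comm] at b2
  have := eq_of_abs_om_sub_le hk hn b1 b2
    (by rw [← hQ, mul_div_cancel₀ _ hQ0.ne'])
  linarith

end PlaneLoop

/-! ### Calculus of loops moved to a base point -/

namespace PlaneLoop

variable {k : ℝ} (hk : 1 < k)

lemma hasDerivAt_curve (z : ℝ × ℝ) (x : PlaneLoop) (t : ℝ) :
    HasDerivAt (curve z x) (z.2 * (vel1 x).ev t, z.2 * (vel2 x).ev t) t :=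
  (((isDeriv_pos1 x t).const_mul z.2).const_add z.1).prodMk ((isDeriv_pos2 x t).const_mul z.2)

lemma deriv_curve (z : ℝ × ℝ) (x : PlaneLoop) :
    deriv (curve z x) = fun t => (z.2 * (vel1 x).ev t, z.2 * (vel2 x).ev t) :=
  funext fun t => (hasDerivAt_curve z x t).deriv

lemma hasDerivAt_deriv_curve (z : ℝ × ℝ) (x : PlaneLoop) (t : ℝ) :
    HasDerivAt (deriv (curve z x)) (z.2 * (acc1 x).ev t, z.2 * (acc2 x).ev t) t := by
  rw [deriv_curve]
  exact ((isDeriv_vel1 x t).const_mul z.2).prodMk ((isDeriv_vel2 x t).const_mul z.2)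

lemma deriv_deriv_curve (z : ℝ × ℝ) (x : PlaneLoop) :
    deriv (deriv (curve z x)) = fun t => (z.2 * (acc1 x).ev t, z.2 * (acc2 x).ev t) :=
  funext fun t => (hasDerivAt_deriv_curve z x t).deriv

lemma contDiff_curve (z : ℝ × ℝ) (x : PlaneLoop) : ContDiff ℝ 2 (curve z x) := by
  rw [show (2 : WithTop ℕ∞) = 1 + 1 by norm_num, contDiff_succ_iff_deriv]
  refine ⟨fun t => (hasDerivAt_curve z x t).differentiableAt, by simp, ?_⟩
  rw [contDiff_one_iff_deriv]
  refine ⟨fun t => (hasDerivAt_deriv_curve z x t).differentiableAt, ?_⟩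
  rw [deriv_deriv_curve]
  exact (continuous_const.mul (acc1 x).continuous_ev).prodMk
    (continuous_const.mul (acc2 x).continuous_ev)

lemma curve_ref (z : ℝ × ℝ) : curve z (ref hk) = omz k z := funext fun t => by
  rw [omz, om_eq hk]
  rfl

lemma deriv_om (t : ℝ) : deriv (om k) t = ((dom1 hk).ev t, (dom2 hk).ev t) := by
  have h : om k = fun s => ((om1 hk).ev s, (om2 hk).ev s) := funext (om_eq hk)
  rw [h]
  exact ((isDeriv_om1 hk t).prodMk (isDeriv_om2 hk t)).deriv

lemma hypL_curve {z : ℝ × ℝ} (hz : 0 < z.2) {x : PlaneLoop} (hx : ∀ t, 0 < (pos2 x).ev t) :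
    hypL (curve z x) = len x := by
  have e (t : ℝ) : ((deriv (curve z x) t).1 ^ 2 + (deriv (curve z x) t).2 ^ 2)
      / (curve z x t).2 ^ 2 = (speedSq x).ev t := by
    have h := (hx t).ne'
    change _ = (Ring.inverse (pos2 x)).ev t ^ 2 * ((vel1 x).ev t ^ 2 + (vel2 x).ev t ^ 2)
    rw [inverse_ev (fun s => (hx s).ne'), deriv_curve]
    simp only [curve]
    field_simp
  rw [hypL, len]
  simp only [e]
  rw [integral_eq_mean, one_div, inv_mul_cancel_left₀ (by positivity)]

lemma integral_dotp_eq_zero (z : ℝ × ℝ) (x : PlaneLoop) {f g : PerC} {v : ℝ → ℝ × ℝ}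
    (hv : ∀ t, v t = (f.ev t, g.ev t))
    (h : mean ((pos1 x - om1 hk) * f + (pos2 x - om2 hk) * g) = 0) :
    ∫ t in (0:ℝ)..(2 * π), dotp (curve z x t - omz k z t) (v t) = 0 := by
  have e (t : ℝ) : dotp (curve z x t - omz k z t) (v t)
      = (z.2 • ((pos1 x - om1 hk) * f + (pos2 x - om2 hk) * g)).ev t := by
    change _ = z.2 * (((pos1 x).ev t - (om1 hk).ev t) * f.ev t
      + ((pos2 x).ev t - (om2 hk).ev t) * g.ev t)
    rw [hv, omz, om_eq hk]
    simp only [dotp, curve, Prod.fst_sub, Prod.snd_sub]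
    ring
  simp only [e]
  rw [integral_eq_mean, map_smul, h, smul_zero, mul_zero]

lemma curve_equation {J : ℝ × ℝ → ℝ} {N : NNReal} (hJ : LipschitzWith N J) {z : ℝ × ℝ}
    (hz : 0 < z.2) {ε : ℝ} {x : PlaneLoop} (hx : eqn hk x + ε • pert hJ z x = 0)
    (hpos : ∀ t, 0 < (pos2 x).ev t) (hm : 0 < mean (dom1 hk * vel1 x + dom2 hk * vel2 x))
    (t : ℝ) :
    -(deriv (deriv (curve z x)) t) + ((curve z x t).2)⁻¹ • Gam (deriv (curve z x) t)
        + (hypL (curve z x) * (k + ε * J (curve z x t))) • rot (deriv (curve z x) t)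
      = ((curve z x t).2 ^ 2) • ((x.2.2.2.1 / z.2) • (((1:ℝ), (0:ℝ)) : ℝ × ℝ)
        + (x.2.2.2.2 / z.2) • om k t) := by
  have hE₁ : eqn1 hk x + ε • (-(along hJ z x * (len x • vel2 x))) = 0 := congrArg (·.1) hx
  have hE₂ : eqn2 hk x + ε • (along hJ z x * (len x • vel1 x)) = 0 := congrArg (·.2.1) hx
  have f₁ : -(acc1 x).ev t + (Ring.inverse (pos2 x)).ev t * (2 * ((vel1 x).ev t * (vel2 x).ev t))
      - len x * k * (vel2 x).ev t
      - (pos2 x).ev t ^ 2 * (x.2.2.1 * (dom1 hk).ev t + x.2.2.2.1 * 1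
        + x.2.2.2.2 * (om1 hk).ev t)
      + ε * (-(J (curve z x t) * (len x * (vel2 x).ev t))) = 0 :=
    congrArg (fun f : PerC => f.ev t) hE₁
  have f₂ : -(acc2 x).ev t
      + (Ring.inverse (pos2 x)).ev t * ((vel2 x).ev t ^ 2 - (vel1 x).ev t ^ 2)
      + len x * k * (vel1 x).ev t
      - (pos2 x).ev t ^ 2 * (x.2.2.1 * (dom2 hk).ev t + x.2.2.2.2 * (om2 hk).ev t)
      + ε * (J (curve z x t) * (len x * (vel1 x).ev t)) = 0 :=
    congrArg (fun f : PerC => f.ev t) hE₂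
  rw [multiplier_eq_zero hk hJ hx hpos hm, inverse_ev (fun s => (hpos s).ne')] at f₁ f₂
  rw [hypL_curve hz hpos, deriv_deriv_curve, deriv_curve, om_eq hk]
  generalize J (curve z x t) = j at *
  have hp := (hpos t).ne'
  ext
  · simp only [curve, Gam, rot, Prod.fst_add, Prod.fst_neg, Prod.smul_fst, smul_eq_mul]
    field_simp at f₁ ⊢
    linear_combination f₁
  · simp only [curve, Gam, rot, Prod.snd_add, Prod.snd_neg, Prod.smul_snd, smul_eq_mul]
    field_simp at f₂ ⊢
    linear_combination f₂

lemma enorm2_smul_le {R d c a b : ℝ} (hc : |c| ≤ R) (ha : |a| ≤ d) (hb : |b| ≤ d) :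
    enorm2 (c * a, c * b) ≤ 2 * (R * d) := by
  have hd := (abs_nonneg a).trans ha
  have hR := (abs_nonneg c).trans hc
  have h₁ : (c * a) ^ 2 ≤ (R * d) ^ 2 := by
    rw [← sq_abs, abs_mul]
    gcongr
  have h₂ : (c * b) ^ 2 ≤ (R * d) ^ 2 := by
    rw [← sq_abs, abs_mul]
    gcongr
  exact Real.sqrt_le_iff.2 ⟨by positivity, by nlinarith [sq_nonneg (R * d)]⟩

lemma enorm2_curve_sub_le {z : ℝ × ℝ} {R d : ℝ} (hz : ‖z‖ ≤ R) {x y : PlaneLoop}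
    (hd : ‖x - y‖ ≤ d) (t : ℝ) :
    enorm2 (curve z x t - curve z y t) + enorm2 (deriv (curve z x) t - deriv (curve z y) t)
      + enorm2 (deriv (deriv (curve z x)) t - deriv (deriv (curve z y)) t) ≤ 6 * (R * d) := by
  have hz2 : |z.2| ≤ R := (norm_snd_le z).trans hz
  have h {f g : PerC} (hp : ‖f - g‖ ≤ ‖x - y‖) : |f.ev t - g.ev t| ≤ d :=
    ((f - g).abs_ev_le t).trans (hp.trans hd)
  have h₀ := enorm2_smul_le hz2
    (h (f := pos1 x) (g := pos1 y) (norm_pos1_le (x - y)))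
    (h (f := pos2 x) (g := pos2 y) (norm_pos2_le (x - y)))
  have h₁ := enorm2_smul_le hz2
    (h (f := vel1 x) (g := vel1 y) (norm_vel1_le (x - y)))
    (h (f := vel2 x) (g := vel2 y) (norm_vel2_le (x - y)))
  have h₂ := enorm2_smul_le hz2
    (h (f := acc1 x) (g := acc1 y) (norm_acc1_le (x - y)))
    (h (f := acc2 x) (g := acc2 y) (norm_acc2_le (x - y)))
  have e₀ : curve z x t - curve z y t = (z.2 * ((pos1 x).ev t - (pos1 y).ev t),
      z.2 * ((pos2 x).ev t - (pos2 y).ev t)) := by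
    ext <;> simp only [curve, Prod.fst_sub, Prod.snd_sub] <;> ring
  have e₁ : deriv (curve z x) t - deriv (curve z y) t
      = (z.2 * ((vel1 x).ev t - (vel1 y).ev t), z.2 * ((vel2 x).ev t - (vel2 y).ev t)) := by
    rw [deriv_curve, deriv_curve]
    ext <;> simp only [Prod.fst_sub, Prod.snd_sub] <;> ring
  have e₂ : deriv (deriv (curve z x)) t - deriv (deriv (curve z y)) t
      = (z.2 * ((acc1 x).ev t - (acc1 y).ev t), z.2 * ((acc2 x).ev t - (acc2 y).ev t)) := by
    rw [deriv_deriv_curve, deriv_deriv_curve]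
    ext <;> simp only [Prod.fst_sub, Prod.snd_sub] <;> ring
  rw [e₀, e₁, e₂]
  linarith

/-- A `C¹` function on the half-plane agrees with a globally Lipschitz one along all loops close
to the reference circle with base point in a compact set. -/
lemma exists_lipschitz_eq_on_curves {K : ℝ × ℝ → ℝ}
    (hK : ContDiffOn ℝ 1 K {z : ℝ × ℝ | 0 < z.2}) (R : ℝ) {c : ℝ} (hc : 0 < c) :
    ∃ (J : ℝ × ℝ → ℝ) (N : NNReal), LipschitzWith N J ∧ ∀ z : ℝ × ℝ, ‖z‖ ≤ R → c ≤ z.2 →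
      ∀ x : PlaneLoop, ‖x - ref hk‖ ≤ √(k ^ 2 - 1) * (k + 1)⁻¹ / 2 →
        ∀ t, K (curve z x t) = J (curve z x t) := by
  set m := √(k ^ 2 - 1) * (k + 1)⁻¹ / 2 with hm
  have hm0 : 0 < m := by
    have := sqrt_sq_sub_one_pos hk
    positivity
  set B : Set (ℝ × ℝ) := Metric.closedBall 0 (|R| + |R| * (‖ref hk‖ + m)) ∩ {w | c * m ≤ w.2}
    with hB
  have hBc : IsCompact B := (isCompact_closedBall _ _).inter_right
    (isClosed_le continuous_const continuous_snd)
  have hBconv : Convex ℝ B := (convex_closedBall _ _).inter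
    (convex_halfSpace_ge (LinearMap.snd ℝ ℝ ℝ).isLinear _)
  have hBK : ContDiffOn ℝ 1 K B := hK.mono fun w hw => (by positivity : 0 < c * m).trans_le hw.2
  obtain ⟨N, hN⟩ := hBK.exists_lipschitzOnWith one_ne_zero hBconv hBc
  obtain ⟨J, hJ, hKJ⟩ := hN.extend_real
  refine ⟨J, N, hJ, fun z hz hcz x hx t => hKJ ⟨?_, ?_⟩⟩
  · rw [mem_closedBall_zero_iff]
    refine (norm_curve_le (hz.trans (le_abs_self R)) x t).trans ?_
    have : ‖x‖ ≤ ‖ref hk‖ + m :=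
      (norm_le_norm_add_norm_sub' x (ref hk)).trans (add_le_add le_rfl hx)
    gcongr
  · exact mul_le_mul hcz (pos2_ev_ge hk hx t) hm0.le (hc.le.trans hcz)

end PlaneLoop

/-- finite-dimensional reduction: for `Ω ⋐ H²` open there are `ε̄ > 0` and a
family of embedded loops `u^ε_z` (for `|ε| ≤ ε̄`, `z ∈ cl Ω`) with `u⁰_z = ω_z`, orthogonal
to `ω', e₁, ω` relative to `ω_z`, solving the `(k+εK)`-equation up to an element
`ω₂²(ϑ₁e₁ + ϑ₂ω)` of the tangent space, and converging to `ω_z` in C² uniformly as `ε → 0`. -/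
theorem stmt_12 (k : ℝ) (hk : 1 < k) (K : (ℝ × ℝ) → ℝ)
    (hK : ContDiffOn ℝ 1 K {z : ℝ × ℝ | 0 < z.2})
    (Ω : Set (ℝ × ℝ)) (hΩo : IsOpen Ω) (hΩc : IsCompact (closure Ω))
    (hΩH : closure Ω ⊆ {z : ℝ × ℝ | 0 < z.2}) :
    ∃ εbar > (0:ℝ), ∃ u : ℝ → (ℝ × ℝ) → ℝ → ℝ × ℝ,
      (∀ ε ∈ Set.Icc (-εbar) εbar, ∀ z ∈ closure Ω,
        ContDiff ℝ 2 (u ε z) ∧ Function.Periodic (u ε z) (2 * π) ∧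
        (∀ t, 0 < (u ε z t).2) ∧ IsEmbedded (u ε z) ∧
        u 0 z = omz k z ∧
        (∫ t in (0:ℝ)..(2 * π), dotp (u ε z t - omz k z t) (deriv (om k) t)) = 0 ∧
        (∫ t in (0:ℝ)..(2 * π), dotp (u ε z t - omz k z t) (((1:ℝ), (0:ℝ)) : ℝ × ℝ)) = 0 ∧
        (∫ t in (0:ℝ)..(2 * π), dotp (u ε z t - omz k z t) (om k t)) = 0 ∧
        ∃ θ1 θ2 : ℝ, ∀ t : ℝ,
          -(deriv (deriv (u ε z)) t) + ((u ε z t).2)⁻¹ • Gam (deriv (u ε z) t)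
              + (hypL (u ε z) * (k + ε * K (u ε z t))) • rot (deriv (u ε z) t)
            = ((u ε z t).2 ^ 2) • (θ1 • (((1:ℝ), (0:ℝ)) : ℝ × ℝ) + θ2 • om k t)) ∧
      (∀ δ > (0:ℝ), ∃ ε1 > (0:ℝ), ∀ ε ∈ Set.Icc (-εbar) εbar, |ε| < ε1 →
        ∀ z ∈ closure Ω, ∀ t : ℝ,
          enorm2 (u ε z t - omz k z t) + enorm2 (deriv (u ε z) t - deriv (omz k z) t)
            + enorm2 (deriv (deriv (u ε z)) t - deriv (deriv (omz k z)) t) < δ) := by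
  obtain ⟨R, hR⟩ : ∃ R, ∀ z ∈ closure Ω, ‖z‖ ≤ R := hΩc.isBounded.exists_norm_le
  obtain ⟨c, hc, hcΩ⟩ : ∃ c, 0 < c ∧ ∀ z ∈ closure Ω, c ≤ z.2 :=
    hΩc.exists_forall_le' continuous_snd.continuousOn hΩH
  obtain ⟨J, N, hJ, hKJ⟩ := PlaneLoop.exists_lipschitz_eq_on_curves hk hK R hc
  obtain ⟨ε₀, hε₀, M, hM, hsol⟩ := PlaneLoop.exists_solution_pert hk hJ R
  obtain ⟨η, hη, hinj⟩ := PlaneLoop.exists_injective_mod_period hk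
  obtain ⟨r, hr, hmean⟩ := Metric.nhds_basis_closedBall.mem_iff.1
    (PlaneLoop.eventually_mean_dom_mul_vel_pos hk)
  set m := √(k ^ 2 - 1) * (k + 1)⁻¹ / 2 with hm
  have hm0 : 0 < m := by
    have := sqrt_sq_sub_one_pos hk
    positivity
  choose! x hxM hx using hsol
  set ρ := min (min m η) r with hρ
  have hρ0 : 0 < ρ := by positivity
  refine ⟨min ε₀ (ρ / M), by positivity, fun ε z => PlaneLoop.curve z (x z ε), ?_, ?_⟩
  · intro ε hε z hz
    have hε' : |ε| ≤ min ε₀ (ρ / M) := abs_le.2 hε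
    have hsol := hx z (hR z hz) ε (hε'.trans (min_le_left _ _))
    have hclose : ‖x z ε - PlaneLoop.ref hk‖ ≤ ρ := by
      refine (hxM z (hR z hz) ε (hε'.trans (min_le_left _ _))).trans ?_
      rw [mul_comm, ← le_div_iff₀ hM]
      exact hε'.trans (min_le_right _ _)
    have hclosem := hclose.trans ((min_le_left _ _).trans (min_le_left _ _))
    have hpos (t : ℝ) : 0 < (PlaneLoop.pos2 (x z ε)).ev t :=
      hm0.trans_le (PlaneLoop.pos2_ev_ge hk hclosem t)
    have hz2 : 0 < z.2 := hΩH hz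
    refine ⟨PlaneLoop.contDiff_curve z _, PlaneLoop.periodic_curve z _,
      fun t => mul_pos hz2 (hpos t), fun t s hts => ?_, ?_,
      PlaneLoop.integral_dotp_eq_zero hk z _ (PlaneLoop.deriv_om hk) ?_,
      PlaneLoop.integral_dotp_eq_zero hk z _ (f := 1) (g := 0) (fun _ => rfl) ?_,
      PlaneLoop.integral_dotp_eq_zero hk z _ (om_eq hk) ?_,
      (x z ε).2.2.2.1 / z.2, (x z ε).2.2.2.2 / z.2, fun t => ?_⟩
    · refine hinj _ (hclose.trans ((min_le_left _ _).trans (min_le_right _ _))) t s ?_ ?_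
      · exact mul_left_cancel₀ hz2.ne' (add_left_cancel (congrArg Prod.fst hts))
      · exact mul_left_cancel₀ hz2.ne' (congrArg Prod.snd hts)
    · have h0 := hxM z (hR z hz) 0 (by simpa using hε₀.le)
      rw [abs_zero, mul_zero] at h0
      have h1 : x z 0 = PlaneLoop.ref hk := sub_eq_zero.1 (norm_le_zero_iff.1 h0)
      simp only [h1]
      exact PlaneLoop.curve_ref hk z
    · have h : _ + ε * 0 = (0 : ℝ) := congrArg (·.2.2.1) hsol
      rwa [mul_zero, add_zero] at h
    · have h : mean (PlaneLoop.pos1 (x z ε) - om1 hk) + ε * 0 = (0 : ℝ) :=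
        congrArg (·.2.2.2.1) hsol
      simpa using h
    · have h : _ + ε * 0 = (0 : ℝ) := congrArg (·.2.2.2.2) hsol
      rwa [mul_zero, add_zero] at h
    · have h := PlaneLoop.curve_equation hk hJ hz2 hsol hpos
        (hmean (mem_closedBall_iff_norm.2 (hclose.trans (min_le_right _ _)))) t
      rw [← hKJ z (hR z hz) (hcΩ z hz) _ hclosem t] at h
      exact h
  · intro δ hδ
    refine ⟨δ / (6 * ((|R| + 1) * M)), by positivity, fun ε hε hεδ z hz t => ?_⟩
    have hε' : |ε| ≤ ε₀ := (abs_le.2 hε).trans (min_le_left _ _)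
    rw [← PlaneLoop.curve_ref hk]
    refine (PlaneLoop.enorm2_curve_sub_le
      ((hR z hz).trans ((le_abs_self R).trans (lt_add_one _).le)) (hxM z (hR z hz) ε hε')
      t).trans_lt ?_
    rw [lt_div_iff₀ (by positivity)] at hεδ
    linarith
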